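/- arXiv:2104.04372 — 3 statements merged into one kernel-verified Lean document; each statement's English description precedes it below -/
import Mathlib

section
/- Let c : ℝ^d × ℝ^d → ℝ be continuous and nonnegative and let ε > 0. Let ν_k (k ∈ ℕ) be a sequence in 𝒫₂^r(ℝ^d) and μ, ν ∈ 𝒫₂^r(ℝ^d), with ν_k converging weakly to ν, and suppose there is C > 0 such that |H(ν_k)|, |H(μ)|, |H(ν)| ≤ C and M(ν_k), M(μ), M(ν) ≤ C for all k. Then W_{c,ε}(μ,ν) ≤ liminf_{k→∞} W_{c,ε}(μ,ν_k). -/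
open MeasureTheory Filter
open scoped ENNReal NNReal RealInnerProductSpace Topology Classical

noncomputable section

/-- `ℝ^d` with the Euclidean norm. -/
abbrev Euc (d : ℕ) : Type := EuclideanSpace ℝ (Fin d)

/-- Second moment `M(ρ) = ∫ ‖x‖² dρ`. -/
def M2 {α : Type*} [NormedAddCommGroup α] [MeasurableSpace α] (ρ : Measure α) : ℝ≥0∞ :=
  ∫⁻ x, (‖x‖₊ : ℝ≥0∞) ^ 2 ∂ρ

/-- `𝒫₂`: probability measures with finite second moment. -/
def IsP2 {α : Type*} [NormedAddCommGroup α] [MeasurableSpace α] (ρ : Measure α) : Prop :=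
  IsProbabilityMeasure ρ ∧ M2 ρ < ⊤

/-- the density of a measure w.r.t. the reference (Lebesgue) measure. -/
def dens {α : Type*} [MeasureSpace α] (ρ : Measure α) (x : α) : ℝ :=
  (ρ.rnDeriv volume x).toReal

/-- `𝒫₂^r`: absolutely continuous members of `𝒫₂`. -/
def IsP2r {α : Type*} [NormedAddCommGroup α] [MeasureSpace α] (ρ : Measure α) : Prop :=
  IsP2 ρ ∧ ρ ≪ (volume : Measure α)

/-- (negative Boltzmann) entropy `H(ρ) = ∫ ρ log ρ` if `ρ` is absolutely continuous
(`+∞` otherwise). -/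
def entropy {α : Type*} [MeasureSpace α] (ρ : Measure α) : EReal :=
  if ρ ≪ (volume : Measure α) ∧
      Integrable (fun x => dens ρ x * Real.log (dens ρ x)) (volume : Measure α)
  then ((∫ x, dens ρ x * Real.log (dens ρ x) ∂(volume : Measure α) : ℝ) : EReal)
  else ⊤

/-- `γ` is a coupling (transport plan) between `μ` and `ν`. -/
def IsCoupling {α : Type*} [MeasurableSpace α] (γ : Measure (α × α)) (μ ν : Measure α) : Prop :=
  γ.fst = μ ∧ γ.snd = ν

/-- `(c, γ) = ∫ c dγ` for a nonnegative cost. -/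
def costInt {α : Type*} [MeasurableSpace α] (c : α × α → ℝ) (γ : Measure (α × α)) : ℝ≥0∞ :=
  ∫⁻ p, ENNReal.ofReal (c p) ∂γ

/-- entropic regularised optimal transport cost `W_{c,ε}`. -/
def transportCost {α : Type*} [MeasureSpace α] (c : α × α → ℝ) (ε : ℝ)
    (μ ν : Measure α) : EReal :=
  ⨅ γ ∈ {γ : Measure (α × α) | IsCoupling γ μ ν},
    ((costInt c γ : EReal) + (ε : EReal) * entropy γ)

/-- potential part of the free energy, `F(ρ) = ∫ f dρ` (`f ≥ 0`). -/
def potentialEnergy {α : Type*} [MeasurableSpace α] (f : α → ℝ) (ρ : Measure α) : EReal :=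
  ((∫⁻ x, ENNReal.ofReal (f x) ∂ρ : ℝ≥0∞) : EReal)

/-- internal part of the free energy, `U(ρ) = ∫ u(ρ(x)) dx` (`+∞` if not a.c.). -/
def internalEnergy {α : Type*} [MeasureSpace α] (u : ℝ → ℝ) (ρ : Measure α) : EReal :=
  if ρ ≪ (volume : Measure α) ∧ Integrable (fun x => u (dens ρ x)) (volume : Measure α)
  then ((∫ x, u (dens ρ x) ∂(volume : Measure α) : ℝ) : EReal)
  else ⊤

/-- free energy `𝓕(ρ) = ∫ f dρ + ∫ u(ρ) dx`. -/
def freeEnergy {α : Type*} [MeasureSpace α] (f : α → ℝ) (u : ℝ → ℝ) (ρ : Measure α) : EReal :=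
  potentialEnergy f ρ + internalEnergy u ρ

/-- the JKO functional `ν ↦ (1/2h) W_{c,ε}(μ,ν) + 𝓕(ν)`. -/
def JKO {α : Type*} [MeasureSpace α] (c : α × α → ℝ) (h ε : ℝ) (f : α → ℝ) (u : ℝ → ℝ)
    (μ ν : Measure α) : EReal :=
  ((1 / (2 * h) : ℝ) : EReal) * transportCost c ε μ ν + freeEnergy f u ν

/-- divergence of a vector field (trace of the Jacobian). -/
def divg {d : ℕ} (F : Euc d → Euc d) (x : Euc d) : ℝ :=
  LinearMap.trace ℝ (Euc d) (fderiv ℝ F x).toLinearMap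

/-- the pressure `p(s) = u'(s) s - u(s)`. -/
def press (u : ℝ → ℝ) (s : ℝ) : ℝ := deriv u s * s - u s

/-- weak convergence of measures (against bounded continuous functions). -/
def WeakTendsto {α : Type*} [TopologicalSpace α] [MeasurableSpace α]
    (μs : ℕ → Measure α) (μ : Measure α) : Prop :=
  ∀ g : BoundedContinuousFunction α ℝ,
    Tendsto (fun k => ∫ x, g x ∂(μs k)) atTop (nhds (∫ x, g x ∂μ))

open InformationTheory Set

theorem mul_le_mul_log_sub_add_exp {s : ℝ} (hs : 0 ≤ s) (t : ℝ) :
    s * t ≤ s * Real.log s - s + Real.exp t := by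
  rcases hs.eq_or_lt with rfl | hs
  · simpa using (Real.exp_pos t).le
  · have h := mul_le_mul_of_nonneg_left (Real.add_one_le_exp (t - Real.log s)) hs.le
    rw [Real.exp_sub, Real.exp_log hs, mul_div_cancel₀ _ hs.ne'] at h
    linarith

/-- A dual bound tested on bounded continuous functions extends to bounded measurable ones. -/
theorem integral_le_add_integral_exp_of_boundedContinuous {X : Type*} [TopologicalSpace X]
    [NormalSpace X] [MeasurableSpace X] [BorelSpace X] {γ π : Measure X}
    [IsFiniteMeasure γ] [IsFiniteMeasure π] [(γ + π).WeaklyRegular] {K : ℝ}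
    (hK : ∀ g : BoundedContinuousFunction X ℝ, ∫ x, g x ∂γ ≤ K + ∫ x, Real.exp (g x) ∂π)
    {h : X → ℝ} (hh : Measurable h) {M : ℝ} (hM : ∀ x, |h x| ≤ M) :
    ∫ x, h x ∂γ ≤ K + ∫ x, Real.exp (h x) ∂π := by
  have hint : ∀ (κ : Measure X) [IsFiniteMeasure κ], Integrable h κ := fun κ _ =>
    Integrable.of_bound hh.aestronglyMeasurable M (ae_of_all _ fun x => by
      simpa using hM x)
  have key : ∀ η > 0, ∫ x, h x ∂γ ≤ K + ∫ x, Real.exp (h x) ∂π + (1 + Real.exp M) * η := by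
    intro η hη
    obtain ⟨g, hg, hgi⟩ := (hint (γ + π)).exists_boundedContinuous_integral_sub_le hη
    have hdi : Integrable (fun x => ‖h x - g x‖) (γ + π) := ((hint _).sub hgi).norm
    rw [integrable_add_measure] at hdi
    rw [integral_add_measure hdi.1 hdi.2] at hg
    have h1 : 0 ≤ ∫ x, ‖h x - g x‖ ∂γ := integral_nonneg fun _ => norm_nonneg _
    have h2 : 0 ≤ ∫ x, ‖h x - g x‖ ∂π := integral_nonneg fun _ => norm_nonneg _
    have hb : ∀ x, ‖max (-M) (min (g x) M)‖ ≤ M := fun x => by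
      have := (abs_nonneg _).trans (hM x)
      rw [Real.norm_eq_abs, abs_le]
      exact ⟨le_max_left _ _, max_le (by linarith) (min_le_right _ _)⟩
    let G : BoundedContinuousFunction X ℝ :=
      BoundedContinuousFunction.ofNormedAddCommGroup (fun x => max (-M) (min (g x) M))
        (by fun_prop) M hb
    have hGM : ∀ x, G x ≤ M := fun x => (le_abs_self _).trans (hb x)
    have hGh : ∀ x, |h x - G x| ≤ ‖h x - g x‖ := fun x => by
      have := abs_le.1 (hM x)
      change |h x - max (-M) (min (g x) M)| ≤ |h x - g x|
      rcases max_cases (-M) (min (g x) M) with e | e <;>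
        rcases min_cases (g x) M with e' | e' <;>
        rcases abs_cases (h x - g x) with e'' | e'' <;> rw [abs_le] <;>
        constructor <;> linarith
    have hexp : ∀ x, Real.exp (G x) ≤ Real.exp (h x) + Real.exp M * ‖h x - g x‖ := fun x => by
      have e1 := mul_le_mul_of_nonneg_left (Real.add_one_le_exp (h x - G x)) (Real.exp_pos (G x)).le
      rw [← Real.exp_add, add_sub_cancel] at e1
      have e2 : Real.exp (G x) * (G x - h x) ≤ Real.exp M * ‖h x - g x‖ :=
        (mul_le_mul_of_nonneg_left ((le_abs_self _).trans ((abs_sub_comm _ _).trans_le (hGh x)))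
          (Real.exp_pos _).le).trans
          (mul_le_mul_of_nonneg_right (Real.exp_le_exp.2 (hGM x)) (norm_nonneg _))
      linarith
    have hexpint : Integrable (fun x => Real.exp (h x)) π :=
      Integrable.of_bound (by fun_prop) (Real.exp M) (ae_of_all _ fun x => by
        rw [Real.norm_eq_abs, Real.abs_exp]
        exact Real.exp_le_exp.2 ((le_abs_self _).trans (hM x)))
    have i1 : ∫ x, h x ∂γ ≤ ∫ x, G x ∂γ + ∫ x, ‖h x - g x‖ ∂γ := by
      rw [← integral_add (G.integrable γ) hdi.1]
      refine integral_mono (hint γ) ((G.integrable γ).add hdi.1) fun x => ?_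
      have := (le_abs_self _).trans (hGh x)
      simp only
      linarith
    have i2 : ∫ x, Real.exp (G x) ∂π ≤
        ∫ x, Real.exp (h x) ∂π + Real.exp M * ∫ x, ‖h x - g x‖ ∂π := by
      rw [← integral_const_mul, ← integral_add hexpint (hdi.2.const_mul _)]
      exact integral_mono_of_nonneg (ae_of_all _ fun x => (Real.exp_pos _).le)
        (hexpint.add (hdi.2.const_mul _)) (ae_of_all _ hexp)
    have i3 := hK G
    have i4 : Real.exp M * ∫ x, ‖h x - g x‖ ∂π ≤ Real.exp M * η :=
      mul_le_mul_of_nonneg_left (by linarith) (Real.exp_pos _).le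
    linarith
  refine le_of_forall_pos_le_add fun η hη => ?_
  have hp : 0 < 1 + Real.exp M := by positivity
  have := key (η / (1 + Real.exp M)) (by positivity)
  rwa [mul_div_cancel₀ _ hp.ne'] at this

theorem absolutelyContinuous_of_integral_le_add_integral_exp {X : Type*} [MeasurableSpace X]
    {γ π : Measure X} [IsFiniteMeasure γ] [IsFiniteMeasure π] {K : ℝ}
    (hK : ∀ h : X → ℝ, Measurable h → (∃ M, ∀ x, |h x| ≤ M) →
      ∫ x, h x ∂γ ≤ K + ∫ x, Real.exp (h x) ∂π) : γ ≪ π := by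
  refine Measure.AbsolutelyContinuous.mk fun N hN hπ => ?_
  by_contra hγ
  have hpos : 0 < γ.real N := by
    rw [measureReal_def]
    exact ENNReal.toReal_pos hγ (measure_ne_top _ _)
  obtain ⟨n, hn⟩ := exists_nat_gt ((K + π.real univ) / γ.real N)
  rw [div_lt_iff₀ hpos] at hn
  have h1 := hK (N.indicator fun _ => (n : ℝ)) (measurable_const.indicator hN)
    ⟨n, fun x => by by_cases hx : x ∈ N <;> simp [hx]⟩
  have h2 : ∫ x, Real.exp (N.indicator (fun _ => (n : ℝ)) x) ∂π = π.real univ := by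
    rw [integral_congr_ae (g := fun _ => (1 : ℝ))]
    · simp
    · filter_upwards [measure_eq_zero_iff_ae_notMem.1 hπ] with x hx
      simp [hx]
  rw [h2, integral_indicator_const _ hN, smul_eq_mul] at h1
  linarith

theorem klFun_max_min_le {a s : ℝ} (ha : 1 ≤ a) :
    klFun (max a⁻¹ (min s a)) ≤
      s * Real.log (max a⁻¹ (min s a)) - max a⁻¹ (min s a) + 1 := by
  have ha' : a⁻¹ ≤ 1 := inv_le_one_of_one_le₀ ha
  have ha0 : 0 < a⁻¹ := by positivity
  set b := max a⁻¹ (min s a) with hb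
  suffices b * Real.log b ≤ s * Real.log b by rw [klFun_apply]; linarith
  rcases le_total 1 s with h | h
  · have h1 : 1 ≤ b := le_max_of_le_right (le_min h ha)
    exact mul_le_mul_of_nonneg_right (max_le (ha'.trans h) (min_le_left _ _)) (Real.log_nonneg h1)
  · have h1 : b ≤ 1 := max_le ha' ((min_le_left _ _).trans h)
    have h2 : s ≤ b := by
      rw [hb, min_eq_left (h.trans ha)]; exact le_max_right _ _
    exact mul_le_mul_of_nonpos_right h2 (Real.log_nonpos (ha0.le.trans (le_max_left _ _)) h1)

theorem integral_klFun_rnDeriv_le_of_integral_le_add_integral_exp {X : Type*} [MeasurableSpace X]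
    {γ π : Measure X} [IsFiniteMeasure γ] [IsFiniteMeasure π] {K : ℝ}
    (hK : ∀ h : X → ℝ, Measurable h → (∃ M, ∀ x, |h x| ≤ M) →
      ∫ x, h x ∂γ ≤ K + ∫ x, Real.exp (h x) ∂π) :
    Integrable (fun x => klFun (γ.rnDeriv π x).toReal) π ∧
      ∫ x, klFun (γ.rnDeriv π x).toReal ∂π ≤ K + π.real univ := by
  have hac := absolutelyContinuous_of_integral_le_add_integral_exp hK
  have hK0 : 0 ≤ K + π.real univ := by simpa using hK (fun _ => 0) measurable_const ⟨0, by simp⟩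
  set F : X → ℝ := fun x => (γ.rnDeriv π x).toReal with hF
  have hFm : Measurable F := (Measure.measurable_rnDeriv _ _).ennreal_toReal
  have hF0 : ∀ x, 0 ≤ F x := fun x => ENNReal.toReal_nonneg
  let b : ℕ → X → ℝ := fun n x => max ((n : ℝ) + 1)⁻¹ (min (F x) ((n : ℝ) + 1))
  have hbm : ∀ n, Measurable (b n) := fun n => by fun_prop
  have hb0 : ∀ n x, 0 < b n x := fun n x => lt_max_of_lt_left (by positivity)
  have ha : ∀ n : ℕ, (1 : ℝ) ≤ (n : ℝ) + 1 := fun n => by simp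
  have hbu : ∀ n x, b n x ≤ (n : ℝ) + 1 := fun n x =>
    max_le ((inv_le_one_of_one_le₀ (ha n)).trans (ha n)) (min_le_right _ _)
  have hlog : ∀ n x, |Real.log (b n x)| ≤ Real.log ((n : ℝ) + 1) := fun n x => by
    rw [abs_le, ← Real.log_inv]
    exact ⟨Real.log_le_log (by positivity) (le_max_left _ _),
      Real.log_le_log (hb0 n x) (hbu n x)⟩
  have hbound : ∀ n, ∫⁻ x, ENNReal.ofReal (klFun (b n x)) ∂π ≤ ENNReal.ofReal (K + π.real univ) := by
    intro n
    have hbi : Integrable (b n) π := Integrable.of_bound (hbm n).aestronglyMeasurable ((n : ℝ) + 1)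
      (ae_of_all _ fun x => by rw [Real.norm_of_nonneg (hb0 n x).le]; exact hbu n x)
    have hli : Integrable (fun x => Real.log (b n x)) γ :=
      Integrable.of_bound (hbm n).log.aestronglyMeasurable _ (ae_of_all _ (hlog n))
    have hFl : Integrable (fun x => F x * Real.log (b n x)) π :=
      (integrable_rnDeriv_smul_iff hac).2 hli
    have hsum : Integrable (fun x => F x * Real.log (b n x) - b n x + 1) π :=
      (hFl.sub hbi).add (integrable_const _)
    calc ∫⁻ x, ENNReal.ofReal (klFun (b n x)) ∂π
        ≤ ∫⁻ x, ENNReal.ofReal (F x * Real.log (b n x) - b n x + 1) ∂π :=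
          lintegral_mono fun x => ENNReal.ofReal_le_ofReal (klFun_max_min_le (ha n))
      _ = ENNReal.ofReal (∫ x, (F x * Real.log (b n x) - b n x + 1) ∂π) :=
          (ofReal_integral_eq_lintegral_ofReal hsum (ae_of_all _ fun x =>
            (klFun_nonneg (hb0 n x).le).trans (klFun_max_min_le (ha n)))).symm
      _ ≤ ENNReal.ofReal (K + π.real univ) := by
          refine ENNReal.ofReal_le_ofReal ?_
          have e0 : ∫ x, (F x * Real.log (b n x) - b n x + 1) ∂π =
              ∫ x, F x * Real.log (b n x) ∂π - ∫ x, b n x ∂π + ∫ _, 1 ∂π := by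
            rw [← integral_sub hFl hbi]
            exact integral_add (hFl.sub hbi) (integrable_const _)
          have e1 : ∫ x, F x * Real.log (b n x) ∂π = ∫ x, Real.log (b n x) ∂γ :=
            integral_rnDeriv_smul hac
          have e2 := hK _ (hbm n).log ⟨_, hlog n⟩
          simp only [Real.exp_log (hb0 n _)] at e2
          rw [e0, e1]
          simp only [integral_const, smul_eq_mul, mul_one]
          linarith
  have hlim : ∀ x, Tendsto (fun n => b n x) atTop (𝓝 (F x)) := fun x => by
    have h1 : Tendsto (fun n : ℕ => ((n : ℝ) + 1)⁻¹) atTop (𝓝 0) := by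
      simpa using tendsto_one_div_add_atTop_nhds_zero_nat (𝕜 := ℝ)
    have h2 : Tendsto (fun n : ℕ => min (F x) ((n : ℝ) + 1)) atTop (𝓝 (F x)) := by
      refine tendsto_const_nhds.congr' ?_
      filter_upwards [eventually_ge_atTop ⌈F x⌉₊] with n hn
      have := Nat.ceil_le.1 hn
      rw [min_eq_left (by linarith)]
    simpa [hF0 x] using h1.max h2
  have hfatou : ∫⁻ x, ENNReal.ofReal (klFun (F x)) ∂π ≤ ENNReal.ofReal (K + π.real univ) := by
    calc ∫⁻ x, ENNReal.ofReal (klFun (F x)) ∂π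
        = ∫⁻ x, liminf (fun n => ENNReal.ofReal (klFun (b n x))) atTop ∂π :=
          lintegral_congr fun x => (Tendsto.liminf_eq ((ENNReal.continuous_ofReal.tendsto _).comp
            ((continuous_klFun.tendsto _).comp (hlim x)))).symm
      _ ≤ liminf (fun n => ∫⁻ x, ENNReal.ofReal (klFun (b n x)) ∂π) atTop :=
          lintegral_liminf_le fun n => (measurable_klFun.comp (hbm n)).ennreal_ofReal
      _ ≤ ENNReal.ofReal (K + π.real univ) :=
          liminf_le_of_le (by isBoundedDefault) fun a h =>
            let ⟨n, hn⟩ := h.exists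
            hn.trans (hbound n)
  have hnn : ∀ x, 0 ≤ klFun (F x) := fun x => klFun_nonneg (hF0 x)
  have hm : AEStronglyMeasurable (fun x => klFun (F x)) π :=
    (measurable_klFun.comp hFm).aestronglyMeasurable
  refine ⟨⟨hm, ?_⟩, ?_⟩
  · rw [hasFiniteIntegral_iff_ofReal (ae_of_all _ hnn)]
    exact hfatou.trans_lt ENNReal.ofReal_lt_top
  · rw [integral_eq_lintegral_of_nonneg_ae (ae_of_all _ hnn) hm]
    exact ENNReal.toReal_le_of_le_ofReal hK0 hfatou

/-- The measure with Lebesgue density `exp (-V)`. -/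
def gibbs {X : Type*} [MeasureSpace X] (V : X → ℝ) : Measure X :=
  (volume : Measure X).withDensity fun x => ENNReal.ofReal (Real.exp (-V x))

section Gibbs

variable {X : Type*} [MeasureSpace X] {V : X → ℝ}

theorem isFiniteMeasure_gibbs (hexp : Integrable (fun x => Real.exp (-V x)) volume) :
    IsFiniteMeasure (gibbs V) :=
  isFiniteMeasure_withDensity_ofReal hexp.2

theorem integral_gibbs (hVm : Measurable V) (f : X → ℝ) :
    ∫ x, f x ∂(gibbs V) = ∫ x, Real.exp (-V x) * f x := by
  rw [gibbs, integral_withDensity_eq_integral_toReal_smul (by fun_prop)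
    (ae_of_all _ fun _ => ENNReal.ofReal_lt_top)]
  simp [ENNReal.toReal_ofReal, (Real.exp_pos _).le]

theorem integrable_gibbs_iff (hVm : Measurable V) (f : X → ℝ) :
    Integrable f (gibbs V) ↔ Integrable (fun x => Real.exp (-V x) * f x) := by
  rw [gibbs, integrable_withDensity_iff_integrable_smul' (by fun_prop)
    (ae_of_all _ fun _ => ENNReal.ofReal_lt_top)]
  simp [ENNReal.toReal_ofReal, (Real.exp_pos _).le]

theorem entropy_eq_coe_iff {γ : Measure X} {E : ℝ} :
    entropy γ = E ↔ γ ≪ volume ∧ Integrable (fun x => dens γ x * Real.log (dens γ x)) ∧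
      ∫ x, dens γ x * Real.log (dens γ x) = E := by
  unfold entropy
  split_ifs with h
  · rw [EReal.coe_eq_coe_iff]
    tauto
  · simp only [EReal.top_ne_coe, false_iff]
    tauto

theorem integral_le_entropy_add_integral_exp [SigmaFinite (volume : Measure X)]
    {γ : Measure X} [IsProbabilityMeasure γ] (hVm : Measurable V)
    (hexp : Integrable (fun x => Real.exp (-V x)) volume) {E : ℝ} (hE : entropy γ = E)
    (hV : Integrable V γ) {h : X → ℝ} (hh : Measurable h) {M : ℝ} (hM : ∀ x, |h x| ≤ M) :
    ∫ x, h x ∂γ ≤ E + ∫ x, V x ∂γ - 1 + ∫ x, Real.exp (h x) ∂(gibbs V) := by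
  obtain ⟨hac, hi, rfl⟩ := entropy_eq_coe_iff.1 hE
  have := isFiniteMeasure_gibbs hexp
  have hhi : Integrable h γ := Integrable.of_bound hh.aestronglyMeasurable M (ae_of_all _ hM)
  have hei : Integrable (fun x => Real.exp (-V x) * Real.exp (h x)) := by
    rw [← integrable_gibbs_iff hVm fun x => Real.exp (h x)]
    refine Integrable.of_bound (by fun_prop) (Real.exp M) (ae_of_all _ fun x => ?_)
    rw [Real.norm_eq_abs, Real.abs_exp]
    exact Real.exp_le_exp.2 ((le_abs_self _).trans (hM x))
  have hdi : Integrable (fun x => dens γ x) := Measure.integrable_toReal_rnDeriv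
  have hd1 : ∫ x, dens γ x = 1 := by
    simpa using! Measure.integral_toReal_rnDeriv hac
  have hl : ∫ x, dens γ x * (h x - V x) = ∫ x, h x ∂γ - ∫ x, V x ∂γ := by
    rw [← integral_sub hhi hV]
    exact integral_toReal_rnDeriv_mul hac
  have hli : Integrable (fun x => dens γ x * (h x - V x)) :=
    (integrable_toReal_rnDeriv_mul_iff hac).2 (hhi.sub hV)
  have hle := integral_mono hli ((hi.sub hdi).add hei) fun x => by
    have := mul_le_mul_log_sub_add_exp (s := dens γ x) ENNReal.toReal_nonneg (h x - V x)
    rwa [sub_eq_neg_add, Real.exp_add, ← sub_eq_neg_add] at this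
  rw [integral_add' (hi.sub hdi) hei, integral_sub' hi hdi, hd1, hl] at hle
  rw [integral_gibbs hVm]
  linarith

theorem entropy_le_of_integral_le_add_integral_exp [SigmaFinite (volume : Measure X)]
    {γ : Measure X} [IsProbabilityMeasure γ] (hVm : Measurable V)
    (hexp : Integrable (fun x => Real.exp (-V x)) volume)
    (hV : Integrable V γ) (hV0 : ∀ x, 0 ≤ V x) {K : ℝ}
    (hK : ∀ h : X → ℝ, Measurable h → (∃ M, ∀ x, |h x| ≤ M) →
      ∫ x, h x ∂γ ≤ K + ∫ x, Real.exp (h x) ∂(gibbs V)) :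
    entropy γ ≤ ((K + 1 : ℝ) : EReal) := by
  have := isFiniteMeasure_gibbs hexp
  have hac := absolutelyContinuous_of_integral_le_add_integral_exp hK
  obtain ⟨hki, hkle⟩ := integral_klFun_rnDeriv_le_of_integral_le_add_integral_exp hK
  have hπ : gibbs V ≪ volume := withDensity_absolutelyContinuous _ _
  set F : X → ℝ := fun x => (γ.rnDeriv (gibbs V) x).toReal with hF
  have hFi : Integrable F (gibbs V) := Measure.integrable_toReal_rnDeriv
  have hF1 : ∫ x, F x ∂(gibbs V) = 1 := by
    simpa using Measure.integral_toReal_rnDeriv hac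
  have hFV : Integrable (fun x => F x * V x) (gibbs V) :=
    (integrable_toReal_rnDeriv_mul_iff hac).2 hV
  have hFV' : ∫ x, F x * V x ∂(gibbs V) = ∫ x, V x ∂γ := integral_toReal_rnDeriv_mul hac
  have hdens : ∀ᵐ x, dens γ x = F x * Real.exp (-V x) := by
    have h1 := Measure.rnDeriv_mul_rnDeriv (κ := (volume : Measure X)) hac
    have h2 : (gibbs V).rnDeriv volume =ᵐ[volume] fun x => ENNReal.ofReal (Real.exp (-V x)) :=
      Measure.rnDeriv_withDensity _ (by fun_prop)
    filter_upwards [h1, h2] with x h1 h2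
    rw [dens, ← h1, Pi.mul_apply, ENNReal.toReal_mul, h2,
      ENNReal.toReal_ofReal (Real.exp_pos _).le]
  have hform : (fun x => dens γ x * Real.log (dens γ x)) =ᵐ[volume]
      fun x => Real.exp (-V x) * (klFun (F x) - 1 + F x - F x * V x) := by
    filter_upwards [hdens] with x hx
    rw [hx, klFun_apply]
    rcases eq_or_ne (F x) 0 with h0 | h0
    · simp [h0]
    · rw [Real.log_mul h0 (Real.exp_pos _).ne', Real.log_exp]
      ring
  have hgi1 : Integrable (fun x => klFun (F x) - 1) (gibbs V) := hki.sub (integrable_const _)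
  have hgi2 : Integrable (fun x => klFun (F x) - 1 + F x) (gibbs V) := hgi1.add hFi
  have hgi : Integrable (fun x => klFun (F x) - 1 + F x - F x * V x) (gibbs V) := hgi2.sub hFV
  have hval : ∫ x, (klFun (F x) - 1 + F x - F x * V x) ∂(gibbs V) =
      ∫ x, klFun (F x) ∂(gibbs V) - (gibbs V).real univ + 1 - ∫ x, V x ∂γ := by
    rw [integral_sub hgi2 hFV, integral_add hgi1 hFi, integral_sub hki (integrable_const _),
      hF1, hFV', integral_const, smul_eq_mul, mul_one]
  have hE : entropy γ = ((∫ x, dens γ x * Real.log (dens γ x) : ℝ) : EReal) :=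
    entropy_eq_coe_iff.2 ⟨hac.trans hπ,
      ((integrable_gibbs_iff hVm _).1 hgi).congr hform.symm, rfl⟩
  rw [hE, EReal.coe_le_coe_iff, integral_congr_ae hform, ← integral_gibbs hVm, hval]
  have := integral_nonneg_of_ae (μ := γ) (ae_of_all _ hV0)
  linarith

end Gibbs

/-- Along a weakly convergent family of probability measures with convergent entropies, the entropy
of the limit exceeds the limit of the entropies by at most a uniform bound on `∫ V`, for any
nonnegative potential `V` with `exp (-V)` integrable. -/
theorem entropy_le_add_of_tendsto {X ι : Type*} [MeasureSpace X] [TopologicalSpace X]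
    [TopologicalSpace.PseudoMetrizableSpace X] [BorelSpace X]
    [SigmaFinite (volume : Measure X)] {V : X → ℝ} (hVm : Measurable V) (hV0 : ∀ x, 0 ≤ V x)
    (hexp : Integrable (fun x => Real.exp (-V x)) volume) {l : Filter ι} [l.NeBot]
    {γs : ι → ProbabilityMeasure X} {γ : ProbabilityMeasure X} (hγ : Tendsto γs l (𝓝 γ))
    {E : ι → ℝ} {e : ℝ} (hE : ∀ i, entropy (γs i : Measure X) = E i) (he : Tendsto E l (𝓝 e))
    (hVs : ∀ i, Integrable V (γs i : Measure X)) (hV : Integrable V (γ : Measure X)) {B : ℝ}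
    (hB : ∀ i, ∫ x, V x ∂(γs i : Measure X) ≤ B) :
    entropy (γ : Measure X) ≤ ((e + B : ℝ) : EReal) := by
  have := isFiniteMeasure_gibbs hexp
  have hK : ∀ g : BoundedContinuousFunction X ℝ,
      ∫ x, g x ∂(γ : Measure X) ≤ (e + B - 1) + ∫ x, Real.exp (g x) ∂(gibbs V) := fun g => by
    refine le_of_tendsto_of_tendsto'
      (ProbabilityMeasure.tendsto_iff_forall_integral_tendsto.1 hγ g)
      (((he.add_const B).sub_const 1).add_const _) fun i => ?_
    have := integral_le_entropy_add_integral_exp hVm hexp (hE i) (hVs i)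
      g.continuous.measurable g.norm_coe_le_norm
    linarith [hB i]
  have := entropy_le_of_integral_le_add_integral_exp hVm hexp hV hV0 fun h hh ⟨M, hM⟩ =>
    integral_le_add_integral_exp_of_boundedContinuous hK hh hM
  simpa using this

theorem integrable_exp_neg_mul_sq_norm {d : ℕ} {δ : ℝ} (hδ : 0 < δ) :
    Integrable (fun x : Euc d => Real.exp (-(δ * ‖x‖ ^ 2))) := by
  have h := GaussianFourier.integrable_cexp_neg_mul_sq_norm_add (V := Euc d) (b := (δ : ℂ))
    (by simpa using hδ) 0 0
  refine h.norm.congr (ae_of_all _ fun x => ?_)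
  simp only [Complex.norm_exp]
  congr 1
  simp [← Complex.ofReal_pow]

/-- The potential `δ (‖x‖² + ‖y‖²)`. -/
def quadPot {d : ℕ} (δ : ℝ) (p : Euc d × Euc d) : ℝ := δ * ‖p.1‖ ^ 2 + δ * ‖p.2‖ ^ 2

theorem measurable_quadPot {d : ℕ} (δ : ℝ) : Measurable (quadPot (d := d) δ) := by
  unfold quadPot; fun_prop

theorem integrable_exp_neg_quadPot {d : ℕ} {δ : ℝ} (hδ : 0 < δ) :
    Integrable (fun p : Euc d × Euc d => Real.exp (-quadPot δ p)) := by
  refine ((integrable_exp_neg_mul_sq_norm (d := d) hδ).mul_prod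
    (integrable_exp_neg_mul_sq_norm (d := d) hδ)).congr (ae_of_all _ fun p => ?_)
  simp only
  rw [← Real.exp_add, quadPot, neg_add]

theorem integrable_sq_norm_of_M2_le {α : Type*} [NormedAddCommGroup α] [MeasurableSpace α]
    [OpensMeasurableSpace α] {ρ : Measure α} {C : ℝ} (hC : 0 ≤ C) (h : M2 ρ ≤ ENNReal.ofReal C) :
    Integrable (fun x => ‖x‖ ^ 2) ρ ∧ ∫ x, ‖x‖ ^ 2 ∂ρ ≤ C := by
  have hm : AEStronglyMeasurable (fun x : α => ‖x‖ ^ 2) ρ :=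
    (measurable_norm.pow_const 2).aestronglyMeasurable
  have h0 : 0 ≤ᵐ[ρ] fun x : α => ‖x‖ ^ 2 := ae_of_all _ fun x => by positivity
  have he : ∫⁻ x, ENNReal.ofReal (‖x‖ ^ 2) ∂ρ = M2 ρ := lintegral_congr fun x => by
    rw [ENNReal.ofReal_pow (norm_nonneg _), ofReal_norm]; rfl
  constructor
  · refine ⟨hm, ?_⟩
    rw [hasFiniteIntegral_iff_ofReal h0, he]
    exact h.trans_lt ENNReal.ofReal_lt_top
  · rw [integral_eq_lintegral_of_nonneg_ae h0 hm, he]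
    exact ENNReal.toReal_le_of_le_ofReal hC h

theorem IsCoupling.integrable_quadPot {d : ℕ} {γ : Measure (Euc d × Euc d)} {μ ν : Measure (Euc d)}
    (hγ : IsCoupling γ μ ν) {C : ℝ} (hC : 0 ≤ C) (hμ : M2 μ ≤ ENNReal.ofReal C)
    (hν : M2 ν ≤ ENNReal.ofReal C) {δ : ℝ} (hδ : 0 ≤ δ) :
    Integrable (quadPot δ) γ ∧ ∫ p, quadPot δ p ∂γ ≤ δ * (2 * C) := by
  obtain ⟨rfl, rfl⟩ := hγ
  obtain ⟨i1, b1⟩ := integrable_sq_norm_of_M2_le hC hμ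
  obtain ⟨i2, b2⟩ := integrable_sq_norm_of_M2_le hC hν
  rw [Measure.fst, integral_map (by fun_prop) i1.1] at b1
  rw [Measure.snd, integral_map (by fun_prop) i2.1] at b2
  have j1 := ((integrable_map_measure i1.1 (by fun_prop)).1 i1).const_mul δ
  have j2 := ((integrable_map_measure i2.1 (by fun_prop)).1 i2).const_mul δ
  refine ⟨j1.add j2, ?_⟩
  calc ∫ p, quadPot δ p ∂γ
      = δ * ∫ p, ‖p.1‖ ^ 2 ∂γ + δ * ∫ p, ‖p.2‖ ^ 2 ∂γ := by
        rw [← integral_const_mul, ← integral_const_mul]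
        exact integral_add j1 j2
    _ ≤ δ * C + δ * C := by gcongr
    _ = δ * (2 * C) := by ring

theorem IsCoupling.isProbabilityMeasure {α : Type*} [MeasurableSpace α] {γ : Measure (α × α)}
    {μ ν : Measure α} [hμ : IsProbabilityMeasure μ] (hγ : IsCoupling γ μ ν) :
    IsProbabilityMeasure γ := by
  refine ⟨?_⟩
  rw [← Measure.fst_univ, hγ.1, measure_univ]

/-- A uniform second-moment bound implies tightness. -/
theorem isTightMeasureSet_of_M2_le {α : Type*} [NormedAddCommGroup α] [ProperSpace α]
    [MeasurableSpace α] [OpensMeasurableSpace α] (C : ℝ) :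
    IsTightMeasureSet {ρ : Measure α | M2 ρ ≤ ENNReal.ofReal C} := by
  refine isTightMeasureSet_of_tendsto_measure_norm_gt ?_
  have hlim : Tendsto (fun r : ℝ => ENNReal.ofReal C / ENNReal.ofReal (r ^ 2)) atTop (𝓝 0) := by
    simpa using ENNReal.Tendsto.const_div (ENNReal.tendsto_ofReal_atTop.comp
      (tendsto_pow_atTop two_ne_zero)) (Or.inr (ENNReal.ofReal_ne_top (r := C)))
  refine tendsto_of_tendsto_of_tendsto_of_le_of_le' tendsto_const_nhds hlim
    (Eventually.of_forall fun _ => zero_le) ?_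
  filter_upwards [eventually_gt_atTop 0] with r hr
  refine iSup₂_le fun ρ hρ => ?_
  have hr2 : ENNReal.ofReal (r ^ 2) ≠ 0 := by simpa using hr.ne'
  rw [ENNReal.le_div_iff_mul_le (Or.inl hr2) (Or.inl ENNReal.ofReal_ne_top), mul_comm]
  refine le_trans ?_ hρ
  refine le_trans ?_ (mul_meas_ge_le_lintegral
    (f := fun x : α => (‖x‖₊ : ℝ≥0∞) ^ 2) (by fun_prop) (ENNReal.ofReal (r ^ 2)))
  have hsub : ∀ x : α, r < ‖x‖ → ENNReal.ofReal (r ^ 2) ≤ (‖x‖₊ : ℝ≥0∞) ^ 2 := fun x hx => by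
    rw [ENNReal.ofReal_pow hr.le, ← enorm_eq_nnnorm, ← ofReal_norm]
    gcongr
  gcongr
  exact hsub _

theorem isCoupling_of_tendsto {α ι : Type*} [TopologicalSpace α] [SecondCountableTopology α]
    [TopologicalSpace.PseudoMetrizableSpace α] [MeasurableSpace α] [BorelSpace α]
    {l : Filter ι} [l.NeBot] {γs : ι → ProbabilityMeasure (α × α)}
    {γ : ProbabilityMeasure (α × α)} (hγ : Tendsto γs l (𝓝 γ)) {μs νs : ι → Measure α}
    {μ ν : Measure α} [IsFiniteMeasure μ] [IsFiniteMeasure ν]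
    (hc : ∀ i, IsCoupling (γs i : Measure (α × α)) (μs i) (νs i))
    (hμ : ∀ g : BoundedContinuousFunction α ℝ, Tendsto (fun i => ∫ x, g x ∂(μs i)) l (𝓝 (∫ x, g x ∂μ)))
    (hν : ∀ g : BoundedContinuousFunction α ℝ, Tendsto (fun i => ∫ x, g x ∂(νs i)) l (𝓝 (∫ x, g x ∂ν))) :
    IsCoupling (γ : Measure (α × α)) μ ν := by
  rw [ProbabilityMeasure.tendsto_iff_forall_integral_tendsto] at hγ
  constructor
  · refine ext_of_forall_integral_eq_of_IsFiniteMeasure fun g => ?_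
    have h := hγ (g.compContinuous ⟨Prod.fst, continuous_fst⟩)
    refine tendsto_nhds_unique ?_ (hμ g)
    rw [Measure.fst, integral_map (by fun_prop) g.continuous.aestronglyMeasurable]
    refine h.congr fun i => ?_
    rw [← (hc i).1, Measure.fst, integral_map (by fun_prop) g.continuous.aestronglyMeasurable]
    rfl
  · refine ext_of_forall_integral_eq_of_IsFiniteMeasure fun g => ?_
    have h := hγ (g.compContinuous ⟨Prod.snd, continuous_snd⟩)
    refine tendsto_nhds_unique ?_ (hν g)
    rw [Measure.snd, integral_map (by fun_prop) g.continuous.aestronglyMeasurable]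
    refine h.congr fun i => ?_
    rw [← (hc i).2, Measure.snd, integral_map (by fun_prop) g.continuous.aestronglyMeasurable]
    rfl

theorem lintegral_ofReal_le_of_tendsto {X ι : Type*} [TopologicalSpace X] [MeasurableSpace X]
    [OpensMeasurableSpace X] {l : Filter ι} [l.NeBot] {γs : ι → ProbabilityMeasure X}
    {γ : ProbabilityMeasure X} (hγ : Tendsto γs l (𝓝 γ)) {c : X → ℝ} (hc : Continuous c)
    (hc0 : ∀ x, 0 ≤ c x) {b : ι → ℝ} {B : ℝ} (hb : Tendsto b l (𝓝 B)) (hb0 : ∀ i, 0 ≤ b i)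
    (hle : ∀ i, ∫⁻ x, ENNReal.ofReal (c x) ∂(γs i : Measure X) ≤ ENNReal.ofReal (b i)) :
    ∫⁻ x, ENNReal.ofReal (c x) ∂(γ : Measure X) ≤ ENNReal.ofReal B := by
  have htrunc : ∀ n : ℕ, ∫⁻ x, ENNReal.ofReal (min (c x) n) ∂(γ : Measure X) ≤ ENNReal.ofReal B := by
    intro n
    have h0 : ∀ x, 0 ≤ min (c x) n := fun x => le_min (hc0 x) n.cast_nonneg
    let g : BoundedContinuousFunction X ℝ :=
      BoundedContinuousFunction.ofNormedAddCommGroup (fun x => min (c x) n) (by fun_prop) n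
        fun x => by rw [Real.norm_of_nonneg (h0 x)]; exact min_le_right _ _
    have hg : ∀ κ : ProbabilityMeasure X, ∫⁻ x, ENNReal.ofReal (min (c x) n) ∂(κ : Measure X) =
        ENNReal.ofReal (∫ x, g x ∂(κ : Measure X)) := fun κ =>
      (ofReal_integral_eq_lintegral_ofReal (g.integrable _) (ae_of_all _ h0)).symm
    rw [hg]
    refine ENNReal.ofReal_le_ofReal (le_of_tendsto_of_tendsto'
      (ProbabilityMeasure.tendsto_iff_forall_integral_tendsto.1 hγ g) hb fun i => ?_)
    rw [← ENNReal.ofReal_le_ofReal_iff (hb0 i), ← hg]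
    exact (lintegral_mono fun x => ENNReal.ofReal_le_ofReal (min_le_left _ _)).trans (hle i)
  calc ∫⁻ x, ENNReal.ofReal (c x) ∂(γ : Measure X)
      = ∫⁻ x, liminf (fun n : ℕ => ENNReal.ofReal (min (c x) n)) atTop ∂(γ : Measure X) := by
        refine lintegral_congr fun x => (Tendsto.liminf_eq (tendsto_const_nhds.congr' ?_)).symm
        filter_upwards [eventually_ge_atTop ⌈c x⌉₊] with n hn
        rw [min_eq_left (Nat.ceil_le.1 hn)]
    _ ≤ liminf (fun n : ℕ => ∫⁻ x, ENNReal.ofReal (min (c x) n) ∂(γ : Measure X)) atTop :=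
        lintegral_liminf_le fun n => by fun_prop
    _ ≤ ENNReal.ofReal B :=
        liminf_le_of_le (by isBoundedDefault) fun a h =>
          let ⟨n, hn⟩ := h.exists
          hn.trans (htrunc n)

theorem entropy_eq_top_or_eq_coe {α : Type*} [MeasureSpace α] (ρ : Measure α) :
    entropy ρ = ⊤ ∨ ∃ E : ℝ, entropy ρ = E := by
  unfold entropy
  split_ifs
  exacts [Or.inr ⟨_, rfl⟩, Or.inl rfl]

theorem costInt_le_of_add_entropy_lt {α : Type*} [MeasureSpace α] {c : α × α → ℝ} {ε a : ℝ}
    (hε : 0 < ε) {γ : Measure (α × α)}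
    (h : (costInt c γ : EReal) + (ε : EReal) * entropy γ < a) :
    ∃ E : ℝ, entropy γ = E ∧ 0 ≤ a - ε * E ∧ costInt c γ ≤ ENNReal.ofReal (a - ε * E) := by
  rcases entropy_eq_top_or_eq_coe γ with hE | ⟨E, hE⟩
  · rw [hE, EReal.coe_mul_top_of_pos hε,
      EReal.add_top_of_ne_bot (EReal.coe_ennreal_ne_bot _)] at h
    exact absurd h not_top_lt
  · rw [hE, ← EReal.coe_mul] at h
    have hlt : (costInt c γ : EReal) < ((a - ε * E : ℝ) : EReal) := by
      rw [EReal.coe_sub]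
      exact EReal.lt_sub_iff_add_lt (Or.inl (EReal.coe_ne_bot _)) (Or.inl (EReal.coe_ne_top _)) |>.2 h
    have h0 : 0 ≤ a - ε * E := by
      exact_mod_cast (EReal.coe_ennreal_nonneg _).trans hlt.le
    refine ⟨E, hE, h0, ?_⟩
    rw [← EReal.coe_ennreal_le_coe_ennreal_iff, EReal.coe_ennreal_ofReal, max_eq_left h0]
    exact hlt.le

theorem IsCoupling.le_entropy {d : ℕ} {γ : Measure (Euc d × Euc d)} {μ ν : Measure (Euc d)}
    [IsProbabilityMeasure μ] (hγ : IsCoupling γ μ ν) {C : ℝ} (hC : 0 ≤ C)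
    (hμ : M2 μ ≤ ENNReal.ofReal C) (hν : M2 ν ≤ ENNReal.ofReal C) {E : ℝ} (hE : entropy γ = E) :
    1 - 2 * C - (gibbs (quadPot (d := d) 1)).real univ ≤ E := by
  have := hγ.isProbabilityMeasure
  obtain ⟨hi, hb⟩ := hγ.integrable_quadPot hC hμ hν zero_le_one
  have h := integral_le_entropy_add_integral_exp (measurable_quadPot 1)
    (integrable_exp_neg_quadPot one_pos) hE hi (h := fun _ => 0) (M := 0) measurable_const
    (by simp)
  simp only [integral_zero, Real.exp_zero, integral_const, smul_eq_mul, mul_one] at h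
  linarith

/-- Along an ultrafilter, couplings with bounded second moments converge weakly to a coupling. -/
theorem exists_tendsto_isCoupling {d : ℕ} {ι : Type*} (U : Ultrafilter ι)
    {γs : ι → ProbabilityMeasure (Euc d × Euc d)} {νs : ι → Measure (Euc d)}
    {μ ν : Measure (Euc d)} [IsFiniteMeasure μ] [IsFiniteMeasure ν]
    (hc : ∀ i, IsCoupling (γs i : Measure (Euc d × Euc d)) μ (νs i)) {C : ℝ}
    (hμ : M2 μ ≤ ENNReal.ofReal C) (hνs : ∀ i, M2 (νs i) ≤ ENNReal.ofReal C)
    (hν : ∀ g : BoundedContinuousFunction (Euc d) ℝ,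
      Tendsto (fun i => ∫ x, g x ∂(νs i)) U (𝓝 (∫ x, g x ∂ν))) :
    ∃ γ : ProbabilityMeasure (Euc d × Euc d), Tendsto γs U (𝓝 γ) ∧
      IsCoupling (γ : Measure (Euc d × Euc d)) μ ν := by
  have htight : IsTightMeasureSet
      {((κ : ProbabilityMeasure (Euc d × Euc d)) : Measure (Euc d × Euc d)) | κ ∈ range γs} := by
    refine IsTightMeasureSet.prodMk ((isTightMeasureSet_of_M2_le C).subset ?_)
      ((isTightMeasureSet_of_M2_le C).subset ?_)
    · rintro _ ⟨_, ⟨_, ⟨i, rfl⟩, rfl⟩, rfl⟩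
      exact ((hc i).1 ▸ hμ : M2 (γs i : Measure (Euc d × Euc d)).fst ≤ _)
    · rintro _ ⟨_, ⟨_, ⟨i, rfl⟩, rfl⟩, rfl⟩
      exact ((hc i).2 ▸ hνs i : M2 (γs i : Measure (Euc d × Euc d)).snd ≤ _)
  obtain ⟨γ, -, hγ⟩ := (isCompact_closure_of_isTightMeasureSet htight).ultrafilter_le_nhds
    (U.map γs) (le_principal_iff.2 (mem_map.2 (Eventually.of_forall fun i =>
      subset_closure ⟨i, rfl⟩)))
  exact ⟨γ, hγ, isCoupling_of_tendsto hγ hc (fun _ => tendsto_const_nhds) hν⟩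

/-- The entropy is lower semicontinuous along couplings with bounded second moments. -/
theorem entropy_le_of_tendsto_of_isCoupling {d : ℕ} {ι : Type*} {l : Filter ι} [l.NeBot]
    {γs : ι → ProbabilityMeasure (Euc d × Euc d)} {γ : ProbabilityMeasure (Euc d × Euc d)}
    (hγ : Tendsto γs l (𝓝 γ)) {μs νs : ι → Measure (Euc d)} {μ ν : Measure (Euc d)}
    (hcs : ∀ i, IsCoupling (γs i : Measure (Euc d × Euc d)) (μs i) (νs i))
    (hc : IsCoupling (γ : Measure (Euc d × Euc d)) μ ν) {C : ℝ} (hC : 0 ≤ C)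
    (hμs : ∀ i, M2 (μs i) ≤ ENNReal.ofReal C) (hνs : ∀ i, M2 (νs i) ≤ ENNReal.ofReal C)
    (hμ : M2 μ ≤ ENNReal.ofReal C) (hν : M2 ν ≤ ENNReal.ofReal C)
    {E : ι → ℝ} (hE : ∀ i, entropy (γs i : Measure (Euc d × Euc d)) = E i) {e : ℝ}
    (he : Tendsto E l (𝓝 e)) :
    entropy (γ : Measure (Euc d × Euc d)) ≤ (e : EReal) := by
  have key : ∀ δ > 0, entropy (γ : Measure (Euc d × Euc d)) ≤ ((e + δ * (2 * C) : ℝ) : EReal) :=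
    fun δ hδ => entropy_le_add_of_tendsto (measurable_quadPot δ)
      (fun p => by unfold quadPot; positivity) (integrable_exp_neg_quadPot hδ) hγ hE he
      (fun i => ((hcs i).integrable_quadPot hC (hμs i) (hνs i) hδ.le).1)
      (hc.integrable_quadPot hC hμ hν hδ.le).1
      (fun i => ((hcs i).integrable_quadPot hC (hμs i) (hνs i) hδ.le).2)
  have hlim : Tendsto (fun δ : ℝ => ((e + δ * (2 * C) : ℝ) : EReal)) (𝓝[>] 0) (𝓝 (e : EReal)) := by
    refine (continuous_coe_real_ereal.tendsto e).comp (Tendsto.mono_left ?_ nhdsWithin_le_nhds)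
    exact Continuous.tendsto' (by fun_prop) _ _ (by simp)
  exact ge_of_tendsto hlim (eventually_nhdsWithin_of_forall fun δ hδ => key δ hδ)

/-- Lemma 5.7, lower semi-continuity of `ν ↦ W_{c,ε}(μ,ν)` restricted to
`𝒫₂^r(ℝ^d)` under uniform entropy and second-moment bounds. -/
theorem statement_5
    (d : ℕ) (c : Euc d × Euc d → ℝ) (ε : ℝ) (hε : 0 < ε)
    (hccont : Continuous c) (hcnonneg : ∀ p : Euc d × Euc d, 0 ≤ c p)
    (νs : ℕ → Measure (Euc d)) (μ ν : Measure (Euc d))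
    (hνs : ∀ k, IsP2r (νs k)) (hμ : IsP2r μ) (hν : IsP2r ν)
    (hweak : WeakTendsto νs ν)
    (C : ℝ) (hC : 0 < C)
    (hHs : ∀ k, ((-C : ℝ) : EReal) ≤ entropy (νs k) ∧ entropy (νs k) ≤ ((C : ℝ) : EReal))
    (hHμ : ((-C : ℝ) : EReal) ≤ entropy μ ∧ entropy μ ≤ ((C : ℝ) : EReal))
    (hHν : ((-C : ℝ) : EReal) ≤ entropy ν ∧ entropy ν ≤ ((C : ℝ) : EReal))
    (hMs : ∀ k, M2 (νs k) ≤ ENNReal.ofReal C)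
    (hMμ : M2 μ ≤ ENNReal.ofReal C) (hMν : M2 ν ≤ ENNReal.ofReal C) :
    transportCost c ε μ ν ≤ Filter.liminf (fun k => transportCost c ε μ (νs k)) Filter.atTop := by
  have := hμ.1.1
  have := hν.1.1
  refine EReal.le_of_forall_lt_iff_le.1 fun a ha => ?_
  have hfreq := frequently_lt_of_liminf_lt (by isBoundedDefault) ha
  let ι := {k // transportCost c ε μ (νs k) < a}
  have : (comap (Subtype.val : ι → ℕ) atTop).NeBot := by
    rw [comap_neBot_iff_frequently]
    exact hfreq.mono fun k hk => ⟨⟨k, hk⟩, rfl⟩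
  let U : Ultrafilter ι := Ultrafilter.of (comap (Subtype.val : ι → ℕ) atTop)
  have hval : Tendsto (Subtype.val : ι → ℕ) U atTop := tendsto_iff_comap.2 (Ultrafilter.of_le _)
  have hex : ∀ i : ι, ∃ γ : Measure (Euc d × Euc d), IsCoupling γ μ (νs i) ∧
      (costInt c γ : EReal) + (ε : EReal) * entropy γ < a := fun i => by
    simpa [transportCost, iInf_lt_iff] using i.2
  choose γs hcs hlt using hex
  choose E hE h0 hcost using fun i => costInt_le_of_add_entropy_lt hε (hlt i)
  obtain ⟨e, -, he⟩ := (isCompact_Icc (a := 1 - 2 * C - (gibbs (quadPot (d := d) 1)).real univ)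
    (b := a / ε)).ultrafilter_le_nhds (U.map E) (le_principal_iff.2 (mem_map.2 <| Eventually.of_forall fun i =>
      ⟨(hcs i).le_entropy hC.le hMμ (hMs i) (hE i), by
        rw [le_div_iff₀ hε]; linarith [h0 i]⟩))
  let γs' : ι → ProbabilityMeasure (Euc d × Euc d) := fun i => ⟨γs i, (hcs i).isProbabilityMeasure⟩
  obtain ⟨γ, hγ, hc⟩ := exists_tendsto_isCoupling (γs := γs') U hcs hMμ (fun i => hMs i)
    fun g => (hweak g).comp hval
  have hent := entropy_le_of_tendsto_of_isCoupling hγ hcs hc hC.le (fun _ => hMμ)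
    (fun i => hMs i) hMμ hMν hE he
  have hb : Tendsto (fun i => a - ε * E i) U (𝓝 (a - ε * e)) :=
    tendsto_const_nhds.sub (Tendsto.const_mul ε he)
  have hcostγ : costInt c (γ : Measure (Euc d × Euc d)) ≤ ENNReal.ofReal (a - ε * e) :=
    lintegral_ofReal_le_of_tendsto hγ hccont hcnonneg hb h0 hcost
  refine iInf₂_le_of_le (γ : Measure (Euc d × Euc d)) hc ?_
  calc (costInt c (γ : Measure (Euc d × Euc d)) : EReal) + (ε : EReal) * entropy _
      ≤ ((a - ε * e : ℝ) : EReal) + (ε : EReal) * (e : EReal) := by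
        refine add_le_add ?_ (mul_le_mul_of_nonneg_left hent (EReal.coe_nonneg.2 hε.le))
        have h := EReal.coe_ennreal_le_coe_ennreal_iff.2 hcostγ
        rwa [EReal.coe_ennreal_ofReal, max_eq_left (ge_of_tendsto' hb h0)] at h
    _ = a := by
        rw [← EReal.coe_mul, ← EReal.coe_add, sub_add_cancel]
end
end

section
/- Let μ_k (k ∈ ℕ) be a sequence in 𝒫₂(ℝ^d) and μ ∈ 𝒫₂(ℝ^d) with μ_k converging weakly to μ and sup_k M(μ_k) < ∞. Then 𝓕(μ) ≤ liminf_{k→∞} 𝓕(μ_k), where 𝓕(ρ) := ∫ f dρ + U(ρ), with U(ρ) := ∫ u(ρ(x)) dx if ρ is absolutely continuous with respect to Lebesgue measure and U(ρ) := +∞ otherwise. -/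
open MeasureTheory Filter
open scoped ENNReal NNReal RealInnerProductSpace Topology Classical

noncomputable section

theorem rpow_le_mul_add_rpow_neg {α s W : ℝ} (hα₀ : 0 < α) (hα₁ : α < 1) (hs : 0 ≤ s)
    (hW : 0 < W) : s ^ α ≤ W * s + W ^ (-(α / (1 - α))) := by
  have hβ : 0 < 1 - α := by linarith
  rcases le_or_gt s (W ^ (-(1 / (1 - α)))) with h | h
  · have h1 : s ^ α ≤ (W ^ (-(1 / (1 - α)))) ^ α := Real.rpow_le_rpow hs h hα₀.le
    rw [← Real.rpow_mul hW.le, show -(1 / (1 - α)) * α = -(α / (1 - α)) by ring] at h1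
    nlinarith [mul_nonneg hW.le hs]
  · have hs0 : 0 < s := (Real.rpow_pos_of_pos hW _).trans h
    have h1 : (W ^ (-(1 / (1 - α)))) ^ (1 - α) ≤ s ^ (1 - α) :=
      Real.rpow_le_rpow (Real.rpow_nonneg hW.le _) h.le hβ.le
    rw [← Real.rpow_mul hW.le, show -(1 / (1 - α)) * (1 - α) = -1 by field_simp,
      Real.rpow_neg_one] at h1
    have h2 : s = s ^ α * s ^ (1 - α) := by
      rw [← Real.rpow_add hs0, add_sub_cancel, Real.rpow_one]
    have h3 : 1 ≤ W * s ^ (1 - α) := by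
      simpa [hW.ne'] using mul_le_mul_of_nonneg_left h1 hW.le
    have h4 : s ^ α * 1 ≤ s ^ α * (W * s ^ (1 - α)) :=
      mul_le_mul_of_nonneg_left h3 (Real.rpow_nonneg hs _)
    have h5 : s ^ α * (W * s ^ (1 - α)) = W * s := by
      calc _ = W * (s ^ α * s ^ (1 - α)) := by ring
        _ = W * s := by rw [← h2]
    have h6 := Real.rpow_nonneg hW.le (-(α / (1 - α)))
    linarith

theorem ConvexOn.tangent_le {S : Set ℝ} {u : ℝ → ℝ} (hu : ConvexOn ℝ S u) {t s : ℝ}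
    (ht : t ∈ S) (hs : s ∈ S) (hd : DifferentiableAt ℝ u t) :
    u t + deriv u t * (s - t) ≤ u s := by
  rcases lt_trichotomy t s with h | rfl | h
  · have := hu.deriv_le_slope ht hs h hd
    rw [slope_def_field, le_div_iff₀ (by linarith)] at this
    linarith
  · simp
  · have := hu.slope_le_deriv hs ht h hd
    rw [slope_def_field, div_le_iff₀ (by linarith)] at this
    linarith

/-- A superlinear function dominates every linear one up to a constant, which is uniform over
all corrections making it nonnegative. -/
theorem exists_mul_le_add_of_superlinear {u : ℝ → ℝ}
    (hu : Tendsto (fun s => u s / s) atTop atTop) {M : ℝ} (hM : 0 ≤ M) :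
    ∃ q : ℝ, 0 ≤ q ∧ ∀ s r : ℝ, 0 ≤ s → 0 ≤ r → 0 ≤ u s + r → M * s ≤ u s + r + q := by
  obtain ⟨s₀, hs₀⟩ := eventually_atTop.1 (hu.eventually_ge_atTop M)
  refine ⟨M * max s₀ 1, by positivity, fun s r hs hr h => ?_⟩
  rcases le_total s (max s₀ 1) with h1 | h1
  · linarith [mul_le_mul_of_nonneg_left h1 hM]
  · have hpos : 0 < s := by linarith [le_max_right s₀ 1]
    have h2 := hs₀ s ((le_max_left _ _).trans h1)
    rw [le_div_iff₀ hpos] at h2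
    have : 0 ≤ M * max s₀ 1 := by positivity
    linarith

theorem measurable_comp_of_continuousOn_Ioi {X : Type*} [MeasurableSpace X] {u : ℝ → ℝ}
    (hu : ContinuousOn u (Set.Ioi 0)) {ρ : X → ℝ} (hρ : Measurable ρ) (hρ0 : ∀ x, 0 ≤ ρ x) :
    Measurable fun x => u (ρ x) := by
  have h1 : Measurable ((Set.Ioi (0 : ℝ)).piecewise u fun _ => u 0) :=
    hu.measurable_piecewise continuousOn_const measurableSet_Ioi
  convert h1.comp hρ using 2 with x
  rcases (hρ0 x).eq_or_lt with h | h
  · simp [← h]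
  · simp [Set.piecewise, h]

theorem integrable_one_add_norm_sq_rpow_neg {d : ℕ} {β : ℝ} (hβ : (d : ℝ) < 2 * β) :
    Integrable fun x : Euc d => (1 + ‖x‖ ^ 2) ^ (-β) := by
  have := integrable_rpow_neg_one_add_norm_sq (E := Euc d) (μ := volume) (r := 2 * β)
    (by simpa using hβ)
  simpa [neg_div] using this

theorem integrable_of_bounded_of_eq_zero {d : ℕ} {h : Euc d → ℝ} {A R : ℝ} (hm : Measurable h)
    (hA : ∀ x, |h x| ≤ A) (h0 : ∀ x, R < ‖x‖ → h x = 0) : Integrable h := by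
  have h1 : IntegrableOn h (Metric.closedBall 0 R) :=
    Measure.integrableOn_of_bounded measure_closedBall_lt_top.ne hm.aestronglyMeasurable
      (ae_of_all _ hA)
  exact h1.integrable_of_forall_notMem_eq_zero fun x hx => h0 x (by simpa using hx)

section Density

variable {X : Type*} [MeasureSpace X]

theorem measurable_dens (ρ : Measure X) : Measurable (dens ρ) :=
  (Measure.measurable_rnDeriv _ _).ennreal_toReal

theorem dens_nonneg (ρ : Measure X) (x : X) : 0 ≤ dens ρ x := ENNReal.toReal_nonneg

variable [SigmaFinite (volume : Measure X)] {ρ : Measure X} [IsFiniteMeasure ρ]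

theorem integrable_mul_dens_iff (hρ : ρ ≪ volume) {h : X → ℝ} :
    Integrable (fun x => h x * dens ρ x) ↔ Integrable h ρ := by
  rw [← integrable_rnDeriv_smul_iff hρ]
  simp only [dens, smul_eq_mul, mul_comm]

theorem integral_mul_dens (hρ : ρ ≪ volume) (h : X → ℝ) :
    ∫ x, h x * dens ρ x = ∫ x, h x ∂ρ := by
  rw [← integral_rnDeriv_smul hρ]
  simp only [dens, smul_eq_mul, mul_comm]

end Density

theorem IsP2.integrable_norm_sq {d : ℕ} {ρ : Measure (Euc d)} (h : IsP2 ρ) :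
    Integrable (fun x => ‖x‖ ^ 2) ρ := by
  refine ⟨by fun_prop, ?_⟩
  rw [HasFiniteIntegral]
  convert h.2 using 1
  simp [M2, enorm_pow]; rfl

theorem IsP2.integral_norm_sq_le {d : ℕ} {ρ : Measure (Euc d)} {K : ℝ} (hK : 0 ≤ K)
    (h : M2 ρ ≤ ENNReal.ofReal K) : ∫ x, ‖x‖ ^ 2 ∂ρ ≤ K := by
  rw [integral_eq_lintegral_of_nonneg_ae (ae_of_all _ fun x => by positivity) (by fun_prop)]
  refine ENNReal.toReal_le_of_le_ofReal hK (le_of_eq_of_le ?_ h)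
  simp [M2, ENNReal.ofReal_pow]; rfl

theorem IsP2.integrable_one_add_norm_sq {d : ℕ} {ρ : Measure (Euc d)} (h : IsP2 ρ) :
    Integrable (fun x => 1 + ‖x‖ ^ 2) ρ := by
  have := h.1
  exact (integrable_const _).add h.integrable_norm_sq

theorem IsP2.integral_one_add_norm_sq_le {d : ℕ} {ρ : Measure (Euc d)} (h : IsP2 ρ) {K : ℝ}
    (hK : 0 ≤ K) (hM : M2 ρ ≤ ENNReal.ofReal K) : ∫ x, (1 + ‖x‖ ^ 2) ∂ρ ≤ 1 + K := by
  have := h.1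
  rw [integral_add (integrable_const _) h.integrable_norm_sq]
  simpa using IsP2.integral_norm_sq_le hK hM

section WeakConvergence

variable {X : Type*} [TopologicalSpace X] [MeasurableSpace X]

/-- A quantitative form of equi-integrability of a family of measures with respect to `ν`. -/
def IsEquiDominated (μs : ℕ → Measure X) (ν : Measure X) : Prop :=
  ∀ ε : ℝ, 0 < ε → ∃ q : ℝ, 0 ≤ q ∧ ∀ (k : ℕ) (A : ℝ) (h : X → ℝ), Measurable h →
    (∀ x, 0 ≤ h x) → (∀ x, h x ≤ A) → Integrable h ν → ∫ x, h x ∂μs k ≤ ε * A + q * ∫ x, h x ∂ν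

variable [BorelSpace X] {μs : ℕ → Measure X} {μ ν : Measure X}

theorem WeakTendsto.le_liminf_measure_open [HasOuterApproxClosed X]
    [∀ k, IsProbabilityMeasure (μs k)] [IsProbabilityMeasure μ] (h : WeakTendsto μs μ)
    {V : Set X} (hV : IsOpen V) : μ V ≤ liminf (fun k => μs k V) atTop := by
  let P : ℕ → ProbabilityMeasure X := fun k => ⟨μs k, inferInstance⟩
  let Q : ProbabilityMeasure X := ⟨μ, inferInstance⟩
  have h1 : Tendsto P atTop (𝓝 Q) := ProbabilityMeasure.tendsto_iff_forall_integral_tendsto.2 h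
  exact ProbabilityMeasure.le_liminf_measure_open_of_tendsto h1 hV

theorem WeakTendsto.absolutelyContinuous [HasOuterApproxClosed X] [ν.OuterRegular]
    [∀ k, IsProbabilityMeasure (μs k)] [IsProbabilityMeasure μ] (h : WeakTendsto μs μ)
    (hd : IsEquiDominated μs ν) : μ ≪ ν := by
  refine Measure.AbsolutelyContinuous.mk fun E _ hE => ?_
  refine le_antisymm (ENNReal.le_of_forall_pos_le_add fun ε hε _ => ?_) bot_le
  obtain ⟨q, hq, hdom⟩ := hd (ε / 2) (by positivity)
  obtain ⟨V, hEV, hV, hνV⟩ := Set.exists_isOpen_lt_of_lt E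
    (ENNReal.ofReal (ε / 2 / (q + 1))) (by rw [hE, ENNReal.ofReal_pos]; positivity)
  have hbound (k : ℕ) : μs k V ≤ ε := by
    have h1 := hdom k 1 (V.indicator 1) (measurable_one.indicator hV.measurableSet)
      (fun x => Set.indicator_nonneg (fun _ _ => zero_le_one) x)
      (fun x => Set.indicator_le_self' (fun _ _ => zero_le_one) x)
      ((integrable_indicator_iff hV.measurableSet).2 (integrableOn_const hνV.ne_top))
    rw [integral_indicator_one hV.measurableSet, integral_indicator_one hV.measurableSet] at h1
    have h2 : ν.real V ≤ ε / 2 / (q + 1) := ENNReal.toReal_le_of_le_ofReal (by positivity) hνV.le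
    have h3 : q * ν.real V ≤ ε / 2 := by
      rw [le_div_iff₀ (by positivity)] at h2
      nlinarith [measureReal_nonneg (μ := ν) (s := V)]
    have h4 : (μs k).real V ≤ ε := by linarith
    rw [← ENNReal.ofReal_coe_nnreal]
    exact (ENNReal.le_ofReal_iff_toReal_le (measure_ne_top _ _) ε.2).2 h4
  calc μ E ≤ μ V := measure_mono hEV
    _ ≤ liminf (fun k => μs k V) atTop := h.le_liminf_measure_open hV
    _ ≤ liminf (fun _ : ℕ => (ε : ℝ≥0∞)) atTop := liminf_le_liminf (Eventually.of_forall hbound)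
    _ = 0 + ε := by simp

/-- Along an equi-dominated weakly convergent sequence, integrals of bounded measurable
functions that are integrable for the dominating measure converge. -/
theorem WeakTendsto.tendsto_integral_of_bounded [NormalSpace X] [R1Space X]
    [WeaklyLocallyCompactSpace X] [(ν + μ).Regular]
    [∀ k, IsProbabilityMeasure (μs k)] [IsProbabilityMeasure μ] (h : WeakTendsto μs μ)
    (hd : IsEquiDominated μs ν) {g : X → ℝ} (hg : Measurable g) (hgi : Integrable g ν) {A : ℝ}
    (hA : ∀ x, |g x| ≤ A) :
    Tendsto (fun k => ∫ x, g x ∂μs k) atTop (𝓝 (∫ x, g x ∂μ)) := by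
  obtain ⟨x₀⟩ := nonempty_of_isProbabilityMeasure μ
  have hA0 : 0 ≤ A := (abs_nonneg _).trans (hA x₀)
  have hgμ (m : Measure X) [IsProbabilityMeasure m] : Integrable g m :=
    Integrable.of_bound hg.aestronglyMeasurable A (ae_of_all _ hA)
  rw [Metric.tendsto_atTop]
  intro ε hε
  obtain ⟨q, hq, hdom⟩ := hd (ε / 4 / (2 * A + 1)) (by positivity)
  obtain ⟨f, hfc, hfi, hf, hfint⟩ :=
    (hgi.add_measure (hgμ μ)).exists_hasCompactSupport_integral_sub_le
      (ε := ε / 4 / (q + 1)) (by positivity)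
  let p : X → ℝ := fun x => max (-A) (min A (f x))
  have hpA (x : X) : |p x| ≤ A :=
    abs_le.2 ⟨le_max_left _ _, max_le (by linarith) (min_le_left _ _)⟩
  have hpc : Continuous p := by fun_prop
  have hpg (x : X) : |g x - p x| ≤ ‖g x - f x‖ := by
    have h1 : g x = max (-A) (min A (g x)) := by
      rw [min_eq_right (abs_le.1 (hA x)).2, max_eq_right (abs_le.1 (hA x)).1]
    rw [h1, Real.norm_eq_abs, ← h1]
    conv_lhs => rw [h1]
    exact (abs_max_sub_max_le_max _ _ _ _).trans (max_le (by simp)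
      ((abs_min_sub_min_le_max _ _ _ _).trans (max_le (by simp) le_rfl)))
  let b : BoundedContinuousFunction X ℝ :=
    BoundedContinuousFunction.ofNormedAddCommGroup p hpc A hpA
  have hpμ (m : Measure X) [IsProbabilityMeasure m] : Integrable p m :=
    Integrable.of_bound hpc.measurable.aestronglyMeasurable A (ae_of_all _ hpA)
  have hgf : Integrable (fun x => ‖g x - f x‖) (ν + μ) :=
    ((hgi.add_measure (hgμ μ)).sub hfint).norm
  have hgfν := hgf.mono_measure (Measure.le_add_right (le_refl ν) : ν ≤ ν + μ)
  have hgfμ := hgf.mono_measure (Measure.le_add_left (le_refl μ) : μ ≤ ν + μ)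
  rw [integral_add_measure hgfν hgfμ] at hfi
  have hdm : Measurable fun x => |g x - p x| := (hg.sub hpc.measurable).abs
  have hdν : Integrable (fun x => |g x - p x|) ν :=
    hgfν.mono' hdm.aestronglyMeasurable (ae_of_all _ fun x => by simpa using hpg x)
  have hdμ : Integrable (fun x => |g x - p x|) μ := ((hgμ μ).sub (hpμ μ)).norm
  have hν : ∫ x, |g x - p x| ∂ν ≤ ∫ x, ‖g x - f x‖ ∂ν := integral_mono hdν hgfν hpg
  have hμ : ∫ x, |g x - p x| ∂μ ≤ ∫ x, ‖g x - f x‖ ∂μ := integral_mono hdμ hgfμ hpg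
  have hν0 : 0 ≤ ∫ x, ‖g x - f x‖ ∂ν := integral_nonneg fun _ => norm_nonneg _
  have hμ0 : 0 ≤ ∫ x, ‖g x - f x‖ ∂μ := integral_nonneg fun _ => norm_nonneg _
  have hqε : q * (ε / 4 / (q + 1)) ≤ ε / 4 ∧ ε / 4 / (q + 1) ≤ ε / 4 := by
    constructor
    · rw [← mul_div_assoc, div_le_iff₀ (by positivity)]; nlinarith
    · exact div_le_self (by positivity) (by linarith)
  have hAε : ε / 4 / (2 * A + 1) * (2 * A) ≤ ε / 4 := by
    rw [div_mul_eq_mul_div, div_le_iff₀ (by positivity)]; nlinarith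
  obtain ⟨N, hN⟩ := Metric.tendsto_atTop.1 (h b) (ε / 4) (by positivity)
  refine ⟨N, fun k hk => ?_⟩
  have h1 : |∫ x, p x ∂μs k - ∫ x, p x ∂μ| < ε / 4 := hN k hk
  have h2 := hdom k (2 * A) (fun x => |g x - p x|) hdm (fun _ => abs_nonneg _)
    (fun x => (abs_sub _ _).trans (by linarith [hA x, hpA x])) hdν
  have h3 (m : Measure X) [IsProbabilityMeasure m] :
      |∫ x, g x ∂m - ∫ x, p x ∂m| ≤ ∫ x, |g x - p x| ∂m := by
    rw [← integral_sub (hgμ m) (hpμ m)]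
    exact abs_integral_le_integral_abs
  have h4 := mul_le_mul_of_nonneg_left (hν.trans (by linarith : _ ≤ ε / 4 / (q + 1))) hq
  rw [Real.dist_eq]
  have h5 := abs_le.1 (h3 (μs k))
  have h6 := abs_le.1 (h3 μ)
  have h7 := abs_lt.1 h1
  exact abs_lt.2 ⟨by linarith, by linarith⟩

theorem WeakTendsto.potentialEnergy_le_liminf [HasOuterApproxClosed X]
    [∀ k, IsProbabilityMeasure (μs k)] [IsProbabilityMeasure μ] (h : WeakTendsto μs μ)
    {f : X → ℝ} (hf : Continuous f) (hf0 : ∀ x, 0 ≤ f x) :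
    potentialEnergy f μ ≤ liminf (fun k => potentialEnergy f (μs k)) atTop := by
  have h1 := lintegral_le_liminf_lintegral_of_forall_isOpen_measure_le_liminf_measure hf hf0
    fun V hV => h.le_liminf_measure_open hV
  refine (EReal.coe_ennreal_le_coe_ennreal_iff.2 h1).trans_eq ?_
  exact Monotone.map_liminf_of_continuousAt EReal.coe_ennreal_strictMono.monotone _
    continuous_coe_ennreal_ereal.continuousAt

end WeakConvergence

theorem integrable_and_integral_le_of_tendsto {X : Type*} [MeasurableSpace X] {μ : Measure X}
    {H : ℕ → X → ℝ} {F : X → ℝ} {c : ℕ → ℝ} {a : ℝ} (hH : ∀ n, Integrable (H n) μ)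
    (hH0 : ∀ n x, 0 ≤ H n x) (hHF : ∀ x, Tendsto (fun n => H n x) atTop (𝓝 (F x)))
    (hc : ∀ n, ∫ x, H n x ∂μ ≤ c n) (hca : Tendsto c atTop (𝓝 a)) :
    Integrable F μ ∧ ∫ x, F x ∂μ ≤ a := by
  have hF0 (x : X) : 0 ≤ F x := ge_of_tendsto' (hHF x) fun n => hH0 n x
  have hFm : AEStronglyMeasurable F μ :=
    aestronglyMeasurable_of_tendsto_ae atTop (fun n => (hH n).1) (ae_of_all _ hHF)
  have ha : 0 ≤ a := ge_of_tendsto' hca fun n => (integral_nonneg (hH0 n)).trans (hc n)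
  have hle : ∫⁻ x, ENNReal.ofReal (F x) ∂μ ≤ ENNReal.ofReal a := by
    calc ∫⁻ x, ENNReal.ofReal (F x) ∂μ
        = ∫⁻ x, liminf (fun n => ENNReal.ofReal (H n x)) atTop ∂μ :=
          lintegral_congr fun x => ((ENNReal.tendsto_ofReal (hHF x)).liminf_eq).symm
      _ ≤ liminf (fun n => ∫⁻ x, ENNReal.ofReal (H n x) ∂μ) atTop :=
          lintegral_liminf_le' fun n => (hH n).1.aemeasurable.ennreal_ofReal
      _ ≤ liminf (fun n => ENNReal.ofReal (c n)) atTop := by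
          refine liminf_le_liminf (Eventually.of_forall fun n => ?_)
          rw [← ofReal_integral_eq_lintegral_ofReal (hH n) (ae_of_all _ (hH0 n))]
          exact ENNReal.ofReal_le_ofReal (hc n)
      _ = ENNReal.ofReal a := (ENNReal.tendsto_ofReal hca).liminf_eq
  refine ⟨⟨hFm, ?_⟩, ?_⟩
  · rw [hasFiniteIntegral_iff_ofReal (ae_of_all _ hF0)]
    exact hle.trans_lt ENNReal.ofReal_lt_top
  · rw [integral_eq_lintegral_of_nonneg_ae (ae_of_all _ hF0) hFm]
    exact ENNReal.toReal_le_of_le_ofReal ha hle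

section Internal

variable {d : ℕ} {u : ℝ → ℝ} {C β ℓ K : ℝ} {μs : ℕ → Measure (Euc d)} {μ : Measure (Euc d)}

theorem isEquiDominated_of_internalEnergy_le (hC : 0 < C) (hβ : (d : ℝ) < 2 * β)
    (hpos : ∀ s W : ℝ, 0 ≤ s → 0 < W → 0 ≤ u s + C * (W * s + W ^ (-β)))
    (husuper : Tendsto (fun s => u s / s) atTop atTop)
    (hμs : ∀ k, IsP2 (μs k)) (hK : 0 ≤ K) (hMs : ∀ k, M2 (μs k) ≤ ENNReal.ofReal K)
    (hac : ∀ k, μs k ≪ volume) (hui : ∀ k, Integrable fun x => u (dens (μs k) x))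
    (hul : ∀ k, ∫ x, u (dens (μs k) x) ≤ ℓ) : IsEquiDominated μs volume := by
  intro ε hε
  have hI := integrable_one_add_norm_sq_rpow_neg hβ
  set J : ℝ := ℓ + C * ((1 + K) + ∫ x : Euc d, (1 + ‖x‖ ^ 2) ^ (-β)) with hJ
  set M : ℝ := (|J| + 1) / ε with hM
  have hM0 : 0 < M := by positivity
  obtain ⟨q, hq, hqs⟩ := exists_mul_le_add_of_superlinear husuper hM0.le
  refine ⟨q / M, by positivity, fun k A h hm h0 hA hi => ?_⟩
  have := (hμs k).1
  have hA0 : 0 ≤ A := (h0 0).trans (hA 0)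
  have hw (x : Euc d) : 0 < 1 + ‖x‖ ^ 2 := by positivity
  have hρ := dens_nonneg (μs k)
  let G : Euc d → ℝ := fun x =>
    u (dens (μs k) x) + C * ((1 + ‖x‖ ^ 2) * dens (μs k) x + (1 + ‖x‖ ^ 2) ^ (-β))
  have hwi := (integrable_mul_dens_iff (hac k)).2 (hμs k).integrable_one_add_norm_sq
  have hwI : Integrable fun x =>
      (1 + ‖x‖ ^ 2) * dens (μs k) x + (1 + ‖x‖ ^ 2) ^ (-β) := hwi.add hI
  have hGi : Integrable G := (hui k).add (hwI.const_mul C)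
  have hG0 (x : Euc d) : 0 ≤ G x := hpos _ _ (hρ x) (hw x)
  have hGJ : ∫ x, G x ≤ J := by
    have h1 : ∫ x, G x = (∫ x, u (dens (μs k) x)) +
        C * ((∫ x, (1 + ‖x‖ ^ 2) ∂μs k) + ∫ x : Euc d, (1 + ‖x‖ ^ 2) ^ (-β)) := by
      rw [integral_add (hui k) (hwI.const_mul C), integral_const_mul,
        integral_add hwi hI, integral_mul_dens (hac k)]
    rw [h1, hJ]
    have h2 := (hμs k).integral_one_add_norm_sq_le hK (hMs k)
    have h3 := hul k
    gcongr
  have hhi : Integrable (fun x => h x * dens (μs k) x) :=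
    (integrable_mul_dens_iff (hac k)).2
      (Integrable.of_bound hm.aestronglyMeasurable A (ae_of_all _ fun x => by
        rw [Real.norm_of_nonneg (h0 x)]; exact hA x))
  have hpt (x : Euc d) : M * (h x * dens (μs k) x) ≤ A * G x + q * h x := by
    have h1 := hqs (dens (μs k) x)
      (C * ((1 + ‖x‖ ^ 2) * dens (μs k) x + (1 + ‖x‖ ^ 2) ^ (-β))) (hρ x)
      (by have := hρ x; have := hw x; positivity) (hG0 x)
    have h2 : h x * (M * dens (μs k) x) ≤ h x * (G x + q) := mul_le_mul_of_nonneg_left h1 (h0 x)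
    nlinarith [mul_le_mul_of_nonneg_right (hA x) (hG0 x)]
  have hint : M * ∫ x, h x ∂μs k ≤ A * J + q * ∫ x, h x := by
    rw [← integral_mul_dens (hac k), ← integral_const_mul]
    calc _ ≤ ∫ x, (A * G x + q * h x) :=
          integral_mono (hhi.const_mul M) ((hGi.const_mul A).add (hi.const_mul q)) hpt
      _ = A * (∫ x, G x) + q * ∫ x, h x := by
          rw [integral_add (hGi.const_mul A) (hi.const_mul q), integral_const_mul,
            integral_const_mul]
      _ ≤ _ := by gcongr
  have hMε : J ≤ M * ε := by
    rw [hM, div_mul_cancel₀ _ hε.ne']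
    linarith [le_abs_self J]
  have h4 : M * (ε * A + q / M * ∫ x, h x) = M * ε * A + q * ∫ x, h x := by
    field_simp
  refine le_of_mul_le_mul_left ?_ hM0
  rw [h4]
  nlinarith [mul_le_mul_of_nonneg_right hMε hA0]

/-- The tangent-line inequality at the density of the limit, integrated over the set where this
density is bounded away from zero and infinity. On the part where the density vanishes the
correction weight is increased by `n`. -/
theorem integral_indicator_le_of_weakTendsto (hC : 0 < C) (hβ : (d : ℝ) < 2 * β)
    (hpos : ∀ s W : ℝ, 0 ≤ s → 0 < W → 0 ≤ u s + C * (W * s + W ^ (-β)))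
    (huconv : ConvexOn ℝ (Set.Ici 0) u) (huC2 : ContDiffOn ℝ 2 u (Set.Ioi 0))
    (hμs : ∀ k, IsP2 (μs k)) (hK : 0 ≤ K) (hMs : ∀ k, M2 (μs k) ≤ ENNReal.ofReal K)
    (hac : ∀ k, μs k ≪ volume) (hui : ∀ k, Integrable fun x => u (dens (μs k) x))
    (hul : ∀ k, ∫ x, u (dens (μs k) x) ≤ ℓ) (hμac : μ ≪ volume) [IsProbabilityMeasure μ]
    (hconv : ∀ (g : Euc d → ℝ) (A : ℝ), Measurable g → Integrable g → (∀ x, |g x| ≤ A) →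
      Tendsto (fun k => ∫ x, g x ∂μs k) atTop (𝓝 (∫ x, g x ∂μ)))
    {δ : ℝ} (hδ : 0 < δ) (n : ℕ) :
    Integrable ({x | ‖x‖ ≤ n ∧ dens μ x ∈ Set.Icc (n + 1 : ℝ)⁻¹ (n + 1)}.indicator fun x =>
      u (dens μ x) + C * (δ * (1 + ‖x‖ ^ 2) * dens μ x + (δ * (1 + ‖x‖ ^ 2)) ^ (-β))) ∧
    Integrable (fun x : Euc d => (δ * (1 + ‖x‖ ^ 2) +
      {x | ‖x‖ ≤ n ∧ dens μ x = 0}.indicator (fun _ => (n : ℝ)) x) ^ (-β)) ∧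
    ∫ x, {x | ‖x‖ ≤ n ∧ dens μ x ∈ Set.Icc (n + 1 : ℝ)⁻¹ (n + 1)}.indicator (fun x =>
      u (dens μ x) + C * (δ * (1 + ‖x‖ ^ 2) * dens μ x + (δ * (1 + ‖x‖ ^ 2)) ^ (-β))) x ≤
    ℓ + C * δ * (1 + K) + C * ∫ x : Euc d, (δ * (1 + ‖x‖ ^ 2) +
      {x | ‖x‖ ≤ n ∧ dens μ x = 0}.indicator (fun _ => (n : ℝ)) x) ^ (-β) := by
  set S : Set (Euc d) := {x | ‖x‖ ≤ n ∧ dens μ x ∈ Set.Icc (n + 1 : ℝ)⁻¹ (n + 1)}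
  set Z : Set (Euc d) := {x | ‖x‖ ≤ n ∧ dens μ x = 0}
  set W : Euc d → ℝ := fun x => δ * (1 + ‖x‖ ^ 2) + Z.indicator (fun _ => (n : ℝ)) x
  set G : Euc d → ℝ := fun x =>
    u (dens μ x) + C * (δ * (1 + ‖x‖ ^ 2) * dens μ x + (δ * (1 + ‖x‖ ^ 2)) ^ (-β))
  have hβ0 : 0 < β := by have : (0 : ℝ) ≤ d := d.cast_nonneg; linarith
  have hn1 : (0 : ℝ) < (n + 1 : ℝ)⁻¹ := by positivity
  have hw (x : Euc d) : 0 < δ * (1 + ‖x‖ ^ 2) := by positivity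
  have hZn (x : Euc d) : 0 ≤ Z.indicator (fun _ => (n : ℝ)) x :=
    Set.indicator_nonneg (fun _ _ => n.cast_nonneg) x
  have hdm := measurable_dens μ
  have hSm : MeasurableSet S :=
    (measurableSet_le measurable_norm measurable_const).inter (hdm measurableSet_Icc)
  have hZm : MeasurableSet Z :=
    (measurableSet_le measurable_norm measurable_const).inter (hdm (measurableSet_singleton 0))
  have hSZ (x : Euc d) (hx : x ∈ S) : x ∉ Z := fun hz => by
    have := hx.2.1
    rw [hz.2] at this
    linarith
  have hIδ : Integrable fun x : Euc d => (δ * (1 + ‖x‖ ^ 2)) ^ (-β) := by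
    refine ((integrable_one_add_norm_sq_rpow_neg hβ).const_mul (δ ^ (-β))).congr
      (ae_of_all _ fun x => ?_)
    exact (Real.mul_rpow hδ.le (by positivity)).symm
  have hWm : Measurable W := by
    have : Measurable (Z.indicator fun _ => (n : ℝ)) := measurable_const.indicator hZm
    fun_prop
  have hIW : Integrable fun x => W x ^ (-β) := by
    refine hIδ.mono' (hWm.pow_const _).aestronglyMeasurable (ae_of_all _ fun x => ?_)
    have h1 : 0 < W x := add_pos_of_pos_of_nonneg (hw x) (hZn x)
    rw [Real.norm_of_nonneg (Real.rpow_nonneg h1.le _)]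
    exact Real.rpow_le_rpow_of_nonpos (hw x) (by linarith [hZn x]) (by linarith)
  have hIcc : Set.Icc (n + 1 : ℝ)⁻¹ (n + 1) ⊆ Set.Ioi 0 := fun t ht => hn1.trans_le ht.1
  have huc : ContinuousOn u (Set.Ioi 0) := huC2.continuousOn
  have hdc : ContinuousOn (deriv u) (Set.Ioi 0) :=
    huC2.continuousOn_deriv_of_isOpen isOpen_Ioi (by norm_num)
  obtain ⟨B, hB⟩ := isCompact_Icc.exists_bound_of_continuousOn (huc.mono hIcc)
  obtain ⟨D, hD⟩ := isCompact_Icc.exists_bound_of_continuousOn (hdc.mono hIcc)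
  have hum : Measurable fun x => u (dens μ x) :=
    measurable_comp_of_continuousOn_Ioi huc hdm (dens_nonneg μ)
  have hSi {g : Euc d → ℝ} (hg : Measurable g) {A : ℝ} (hA : ∀ x ∈ S, |g x| ≤ A) :
      Integrable (S.indicator g) := by
    refine integrable_of_bounded_of_eq_zero (A := |A|) (R := n) (hg.indicator hSm) (fun x => ?_)
      fun x hx => Set.indicator_of_notMem (fun h => absurd h.1 (not_le.2 hx)) _
    by_cases hx : x ∈ S
    · rw [Set.indicator_of_mem hx]; exact (hA x hx).trans (le_abs_self A)
    · simp [hx]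
  have hSsq (x : Euc d) (hx : x ∈ S) : ‖x‖ ^ 2 ≤ (n : ℝ) ^ 2 :=
    pow_le_pow_left₀ (norm_nonneg x) hx.1 2
  have hGi : Integrable (S.indicator G) := by
    refine hSi (A := B + C * (δ * (1 + n ^ 2) * (n + 1) + δ ^ (-β)))
      (hum.add (Measurable.const_mul (by fun_prop) C)) fun x hx => ?_
    have h1 := hB _ hx.2
    have h2 : (δ * (1 + ‖x‖ ^ 2)) ^ (-β) ≤ δ ^ (-β) :=
      Real.rpow_le_rpow_of_nonpos hδ (by nlinarith [sq_nonneg ‖x‖]) (by linarith)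
    have h3 := Real.rpow_nonneg (hw x).le (-β)
    have h4 := dens_nonneg μ x
    refine (abs_add_le _ _).trans (add_le_add h1 ?_)
    rw [abs_of_nonneg (by have := hw x; positivity)]
    have h5 := hx.2.2
    have h6 := hSsq x hx
    gcongr
  let h : Euc d → ℝ := fun x =>
    S.indicator (fun x => deriv u (dens μ x) + C * (δ * (1 + ‖x‖ ^ 2))) x -
      C * Z.indicator (fun _ => (n : ℝ)) x
  have hh : ∃ A : ℝ, ∀ x, |h x| ≤ A := by
    refine ⟨|D + C * (δ * (1 + n ^ 2))| + C * n, fun x => (abs_sub _ _).trans (add_le_add ?_ ?_)⟩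
    · by_cases hx : x ∈ S
      · rw [Set.indicator_of_mem hx]
        refine le_trans ((abs_add_le _ _).trans ?_) (le_abs_self _)
        rw [abs_of_nonneg (by positivity : 0 ≤ C * (δ * (1 + ‖x‖ ^ 2)))]
        have h1 := hD _ hx.2
        rw [Real.norm_eq_abs] at h1
        have h6 := hSsq x hx
        gcongr
      · simp [hx]
    · rw [abs_of_nonneg (mul_nonneg hC.le (hZn x))]
      refine mul_le_mul_of_nonneg_left ?_ hC.le
      exact Set.indicator_le_self' (fun _ _ => n.cast_nonneg) x
  obtain ⟨A, hA⟩ := hh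
  have hhm : Measurable h := by
    have h1 : Measurable (Z.indicator fun _ => (n : ℝ)) := measurable_const.indicator hZm
    have h2 : Measurable (S.indicator fun x => deriv u (dens μ x) + C * (δ * (1 + ‖x‖ ^ 2))) :=
      (((measurable_deriv u).comp hdm).add (by fun_prop)).indicator hSm
    exact h2.sub (h1.const_mul C)
  have hhi : Integrable h := by
    refine integrable_of_bounded_of_eq_zero hhm hA (R := n) fun x hx => ?_
    have h1 : x ∉ S := fun h => absurd h.1 (not_le.2 hx)
    have h2 : x ∉ Z := fun h => absurd h.1 (not_le.2 hx)
    simp [h, h1, h2]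
  have hpt (x : Euc d) (s : ℝ) (hs : 0 ≤ s) : S.indicator G x + h x * s - h x * dens μ x ≤
      u s + C * δ * ((1 + ‖x‖ ^ 2) * s) + C * W x ^ (-β) := by
    have h1 := hpos s (W x) hs (add_pos_of_pos_of_nonneg (hw x) (hZn x))
    by_cases hx : x ∈ S
    · have hxZ := hSZ x hx
      have h2 := huconv.tangent_le (Set.Ioi_subset_Ici_self (hIcc hx.2)) hs
        ((huC2.differentiableOn (by norm_num)).differentiableAt (Ioi_mem_nhds (hIcc hx.2)))
      simp only [h, W, G, Set.indicator_of_mem hx, Set.indicator_of_notMem hxZ, add_zero,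
        mul_zero, sub_zero]
      linarith
    · by_cases hxZ : x ∈ Z
      · simp only [h, W, Set.indicator_of_notMem hx, Set.indicator_of_mem hxZ, hxZ.2] at h1 ⊢
        linarith
      · simp only [h, W, Set.indicator_of_notMem hx, Set.indicator_of_notMem hxZ] at h1 ⊢
        linarith
  have hhb (m : Measure (Euc d)) [IsProbabilityMeasure m] : Integrable h m :=
    Integrable.of_bound hhm.aestronglyMeasurable A (ae_of_all _ hA)
  refine ⟨hGi, hIW, ?_⟩
  have hlim := (tendsto_const_nhds (x := ∫ x, S.indicator G x)).add
    ((hconv h A hhm hhi hA).sub_const (∫ x, h x ∂μ))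
  rw [sub_self, add_zero] at hlim
  refine le_of_tendsto' hlim fun k => ?_
  have := (hμs k).1
  have hhk := (integrable_mul_dens_iff (hac k)).2 (hhb (μs k))
  have hhμ := (integrable_mul_dens_iff hμac).2 (hhb μ)
  have hwi := (integrable_mul_dens_iff (hac k)).2 (hμs k).integrable_one_add_norm_sq
  have hl : Integrable fun x => S.indicator G x + h x * dens (μs k) x := hGi.add hhk
  have hr : Integrable fun x =>
      u (dens (μs k) x) + C * δ * ((1 + ‖x‖ ^ 2) * dens (μs k) x) :=
    (hui k).add (hwi.const_mul (C * δ))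
  have hint := integral_mono (hl.sub hhμ) (hr.add (hIW.const_mul C))
    fun x => hpt x (dens (μs k) x) (dens_nonneg _ x)
  simp only [Pi.add_apply, Pi.sub_apply] at hint
  rw [integral_sub hl hhμ, integral_add hGi hhk, integral_add hr (hIW.const_mul C),
    integral_add (hui k) (hwi.const_mul (C * δ)), integral_const_mul, integral_const_mul,
    integral_mul_dens (hac k), integral_mul_dens hμac, integral_mul_dens (hac k)] at hint
  have h2 := mul_le_mul_of_nonneg_left ((hμs k).integral_one_add_norm_sq_le hK (hMs k))
    (by positivity : 0 ≤ C * δ)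
  linarith [hul k]

/-- The internal energy is lower semicontinuous along sequences with bounded internal energy. -/
theorem internalEnergy_le_of_weakTendsto (hC : 0 < C) (hβ : (d : ℝ) < 2 * β)
    (hpos : ∀ s W : ℝ, 0 ≤ s → 0 < W → 0 ≤ u s + C * (W * s + W ^ (-β)))
    (huconv : ConvexOn ℝ (Set.Ici 0) u) (huC2 : ContDiffOn ℝ 2 u (Set.Ioi 0)) (hu0 : u 0 = 0)
    (husuper : Tendsto (fun s => u s / s) atTop atTop)
    (hμs : ∀ k, IsP2 (μs k)) (hμ : IsP2 μ) (hweak : WeakTendsto μs μ)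
    (hK : 0 ≤ K) (hMs : ∀ k, M2 (μs k) ≤ ENNReal.ofReal K)
    (hac : ∀ k, μs k ≪ volume) (hui : ∀ k, Integrable fun x => u (dens (μs k) x))
    (hul : ∀ k, ∫ x, u (dens (μs k) x) ≤ ℓ) : internalEnergy u μ ≤ ℓ := by
  have hprob (k : ℕ) : IsProbabilityMeasure (μs k) := (hμs k).1
  have := hμ.1
  have hdom := isEquiDominated_of_internalEnergy_le hC hβ hpos husuper hμs hK hMs hac hui hul
  have hμac : μ ≪ volume := hweak.absolutelyContinuous hdom
  have hβ0 : 0 < β := by have : (0 : ℝ) ≤ d := d.cast_nonneg; linarith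
  have hρ0 := dens_nonneg μ
  have : IsFiniteMeasureOnCompacts (volume + μ) :=
    ⟨fun _ h => ENNReal.add_lt_top.2 ⟨h.measure_lt_top, h.measure_lt_top⟩⟩
  have : IsLocallyFiniteMeasure (volume + μ) :=
    isLocallyFiniteMeasure_of_isFiniteMeasureOnCompacts
  have hconv (g : Euc d → ℝ) (A : ℝ) (hg : Measurable g) (hgi : Integrable g)
      (hA : ∀ x, |g x| ≤ A) : Tendsto (fun k => ∫ x, g x ∂μs k) atTop (𝓝 (∫ x, g x ∂μ)) :=
    hweak.tendsto_integral_of_bounded hdom hg hgi hA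
  have hwi := (integrable_mul_dens_iff hμac).2 hμ.integrable_one_add_norm_sq
  have key (δ : ℝ) (hδ : 0 < δ) : Integrable (fun x => u (dens μ x)) ∧
      ∫ x, u (dens μ x) ≤ ℓ + C * δ * (1 + K) := by
    have hw (x : Euc d) : 0 < δ * (1 + ‖x‖ ^ 2) := by positivity
    have hstep := integral_indicator_le_of_weakTendsto hC hβ hpos huconv huC2 hμs hK hMs hac hui
      hul hμac hconv hδ
    let V : Euc d → ℝ := {x | 0 < dens μ x}.indicator fun x => (δ * (1 + ‖x‖ ^ 2)) ^ (-β)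
    let F : Euc d → ℝ := fun x =>
      u (dens μ x) + C * δ * ((1 + ‖x‖ ^ 2) * dens μ x) + C * V x
    have hIδ : Integrable fun x : Euc d => (δ * (1 + ‖x‖ ^ 2)) ^ (-β) := by
      refine ((integrable_one_add_norm_sq_rpow_neg hβ).const_mul (δ ^ (-β))).congr
        (ae_of_all _ fun x => ?_)
      exact (Real.mul_rpow hδ.le (by positivity)).symm
    have hVi : Integrable V := hIδ.indicator (measurable_dens μ measurableSet_Ioi)
    have hlarge (x : Euc d) : ∀ᶠ n : ℕ in atTop, ‖x‖ ≤ n :=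
      tendsto_natCast_atTop_atTop.eventually_ge_atTop _
    have hV : Tendsto (fun n : ℕ => ∫ x : Euc d, (δ * (1 + ‖x‖ ^ 2) +
        {x | ‖x‖ ≤ n ∧ dens μ x = 0}.indicator (fun _ => (n : ℝ)) x) ^ (-β)) atTop
        (𝓝 (∫ x, V x)) := by
      refine tendsto_integral_of_dominated_convergence _ (fun n => (hstep n).2.1.1) hIδ
        (fun n => ae_of_all _ fun x => ?_) (ae_of_all _ fun x => ?_)
      · have h1 : 0 ≤ {x | ‖x‖ ≤ n ∧ dens μ x = 0}.indicator (fun _ => (n : ℝ)) x :=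
          Set.indicator_nonneg (fun _ _ => n.cast_nonneg) x
        rw [Real.norm_of_nonneg (Real.rpow_nonneg (add_nonneg (hw x).le h1) _)]
        exact Real.rpow_le_rpow_of_nonpos (hw x) (by linarith) (by linarith)
      · rcases (hρ0 x).eq_or_lt with h0 | h0
        · have hVx : V x = 0 := Set.indicator_of_notMem (by simp [← h0]) _
          rw [hVx]
          have h1 := (tendsto_rpow_neg_atTop hβ0).comp
            (tendsto_atTop_add_const_left atTop (δ * (1 + ‖x‖ ^ 2))
              (tendsto_natCast_atTop_atTop (R := ℝ)))
          refine h1.congr' ((hlarge x).mono fun n hn => ?_)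
          simp [hn, ← h0]
        · have hVx : V x = (δ * (1 + ‖x‖ ^ 2)) ^ (-β) :=
            Set.indicator_of_mem (s := {x | 0 < dens μ x}) h0 _
          rw [hVx]
          refine tendsto_const_nhds.congr fun n => ?_
          simp [h0.ne']
    have hF := integrable_and_integral_le_of_tendsto (F := F) (fun n => (hstep n).1)
      (fun n x => Set.indicator_nonneg (fun x _ => hpos _ _ (hρ0 x) (hw x)) x)
      (fun x => ?_) (fun n => (hstep n).2.2) ((hV.const_mul C).const_add _)
    · have hFu (x : Euc d) : u (dens μ x) =
          F x - C * δ * ((1 + ‖x‖ ^ 2) * dens μ x) - C * V x := by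
        simp only [F]; ring
      have h1 : Integrable fun x => F x - C * δ * ((1 + ‖x‖ ^ 2) * dens μ x) :=
        hF.1.sub (hwi.const_mul _)
      simp_rw [hFu]
      refine ⟨h1.sub (hVi.const_mul C), ?_⟩
      rw [integral_sub h1 (hVi.const_mul C), integral_sub hF.1 (hwi.const_mul _),
        integral_const_mul, integral_const_mul]
      have h2 : 0 ≤ ∫ x, (1 + ‖x‖ ^ 2) * dens μ x :=
        integral_nonneg fun x => mul_nonneg (by positivity) (hρ0 x)
      have h3 : 0 ≤ C * δ * ∫ x, (1 + ‖x‖ ^ 2) * dens μ x := by positivity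
      linarith [hF.2]
    · rcases (hρ0 x).eq_or_lt with h0 | h0
      · have hFx : F x = 0 := by simp [F, V, ← h0, hu0]
        rw [hFx]
        refine tendsto_const_nhds.congr fun n => (Set.indicator_of_notMem (fun hx => ?_) _).symm
        have := hx.2.1
        rw [← h0] at this
        have : (0 : ℝ) < (n + 1 : ℝ)⁻¹ := by positivity
        linarith
      · refine tendsto_const_nhds.congr' ?_
        filter_upwards [hlarge x,
          (tendsto_natCast_atTop_atTop (R := ℝ)).eventually_ge_atTop (dens μ x),
          (tendsto_natCast_atTop_atTop (R := ℝ)).eventually_ge_atTop (dens μ x)⁻¹] with n h1 h2 h3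
        rw [Set.indicator_of_mem]
        · have hVx : V x = (δ * (1 + ‖x‖ ^ 2)) ^ (-β) :=
            Set.indicator_of_mem (s := {x | 0 < dens μ x}) h0 _
          simp only [F, hVx]
          ring
        · exact ⟨h1, inv_le_of_inv_le₀ h0 (by linarith), by linarith⟩
  rw [internalEnergy, if_pos ⟨hμac, (key 1 one_pos).1⟩, EReal.coe_le_coe_iff]
  refine le_of_forall_pos_le_add fun ε hε => ?_
  have h1 := (key (ε / (C * (1 + K))) (by positivity)).2
  rwa [show C * (ε / (C * (1 + K))) * (1 + K) = ε by field_simp] at h1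

end Internal

/-- Lemma 5.8, lower semi-continuity of the free energy `𝓕` under weak
convergence with uniformly bounded second moments. -/
theorem statement_6
    (d : ℕ) (f : Euc d → ℝ) (u : ℝ → ℝ) (C α : ℝ)
    (hC : 0 < C)
    -- Assumption 2.1 (free energy)
    (hf0 : ∀ x, 0 ≤ f x) (hfc : Continuous f)
    (hfL : ∀ x y, |f x - f y| ≤ C * ‖x - y‖)
    (huconv : ConvexOn ℝ (Set.Ici 0) u)
    (huC2 : ContDiffOn ℝ 2 u (Set.Ioi 0))
    (hu0 : u 0 = 0)
    (husuper : Tendsto (fun s => u s / s) atTop atTop)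
    (hα₁ : (d : ℝ) / (d + 2) < α) (hα₂ : α < 1)
    (hulb : ∀ s : ℝ, 0 ≤ s → -C * s ^ α ≤ u s)
    -- the weakly convergent sequence
    (μs : ℕ → Measure (Euc d)) (μ : Measure (Euc d))
    (hμs : ∀ k, IsP2 (μs k)) (hμ : IsP2 μ)
    (hweak : WeakTendsto μs μ)
    (hMs : ∃ K : ℝ, ∀ k, M2 (μs k) ≤ ENNReal.ofReal K) :
    freeEnergy f u μ ≤ Filter.liminf (fun k => freeEnergy f u (μs k)) Filter.atTop := by
  obtain ⟨K, hK⟩ := hMs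
  have hK' (k : ℕ) : M2 (μs k) ≤ ENNReal.ofReal (max K 0) :=
    (hK k).trans (ENNReal.ofReal_le_ofReal (le_max_left _ _))
  have hd : (0 : ℝ) ≤ d := d.cast_nonneg
  have hα₀ : 0 < α := lt_of_le_of_lt (by positivity) hα₁
  have hβ : (d : ℝ) < 2 * (α / (1 - α)) := by
    rw [div_lt_iff₀ (by positivity)] at hα₁
    rw [← mul_div_assoc, lt_div_iff₀ (by linarith)]
    linarith
  have hpos (s W : ℝ) (hs : 0 ≤ s) (hW : 0 < W) :
      0 ≤ u s + C * (W * s + W ^ (-(α / (1 - α)))) := by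
    have h1 := mul_le_mul_of_nonneg_left (rpow_le_mul_add_rpow_neg hα₀ hα₂ hs hW) hC.le
    linarith [hulb s hs]
  have hprob (k : ℕ) : IsProbabilityMeasure (μs k) := (hμs k).1
  have := hμ.1
  refine (add_le_add (hweak.potentialEnergy_le_liminf hfc hf0) ?_).trans EReal.le_liminf_add
  refine EReal.le_of_forall_lt_iff_le.1 fun ℓ hℓ => ?_
  obtain ⟨φ, hφ, hφℓ⟩ := extraction_of_frequently_atTop
    (frequently_lt_of_liminf_lt (by isBoundedDefault) hℓ)
  have hfin (k : ℕ) : (μs (φ k) ≪ volume ∧ Integrable fun x => u (dens (μs (φ k)) x)) ∧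
      ∫ x, u (dens (μs (φ k)) x) ≤ ℓ := by
    have h1 := hφℓ k
    rw [internalEnergy] at h1
    split_ifs at h1 with h2
    · exact ⟨h2, (EReal.coe_lt_coe_iff.1 h1).le⟩
    · exact absurd h1 not_top_lt
  exact internalEnergy_le_of_weakTendsto hC hβ hpos huconv huC2 hu0 husuper (fun k => hμs (φ k))
    hμ (fun g => (hweak g).comp hφ.tendsto_atTop) (le_max_right _ _) (fun k => hK' (φ k))
    (fun k => (hfin k).1.1) (fun k => (hfin k).1.2) fun k => (hfin k).2
end
end

section
/- Let u satisfy Assumption 2.1, let f : ℝ^d → [0,∞) be differentiable and Lipschitz, and let ν ∈ 𝒫₂^r(ℝ^d) with U(ν) < ∞. Let η ∈ C_c^∞(ℝ^d; ℝ^d) and let Φ : [0,∞) × ℝ^d → ℝ^d be the flow of η, i.e. ∂_s Φ_s(x) = η(Φ_s(x)) with Φ₀ = id. Then the map s ↦ 𝓕((Φ_s)_# ν) is differentiable at s = 0 and d/ds 𝓕((Φ_s)_# ν)|_{s=0} = ∫_{ℝ^d} ν(y) ⟨η(y), ∇f(y)⟩ dy − ∫_{ℝ^d} p(ν(y)) div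 η(y) dy, where p(s) := u'(s)s − u(s). -/
open MeasureTheory Filter
open scoped ENNReal NNReal RealInnerProductSpace Topology Classical

noncomputable section

/-- the (real-valued) free energy `𝓕(ρ) = ∫ f dρ + ∫ u(ρ(x)) dx`. -/
def freeEnergyReal {d : ℕ} (f : Euc d → ℝ) (u : ℝ → ℝ) (ρ : Measure (Euc d)) : ℝ :=
  (∫ x, f x ∂ρ) + ∫ x, u (dens ρ x)

section Flow

variable {E : Type*} [NormedAddCommGroup E] [NormedSpace ℝ E] {η ζ : E → E} {Φ : ℝ → E → E}
  {K K' : ℝ≥0}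

lemma norm_flow_sub_le_of_nonneg (hη : LipschitzWith K η) (hΦ0 : Φ 0 = id)
    (hΦ : ∀ s x, HasDerivAt (fun r => Φ r x) (η (Φ s x)) s) {s : ℝ} (hs : 0 ≤ s) (hs1 : s ≤ 1)
    (x y : E) : ‖Φ s x - Φ s y‖ ≤ Real.exp K * ‖x - y‖ := by
  have h := dist_le_of_trajectories_ODE (v := fun _ => η) (K := K) (f := fun r => Φ r x)
    (g := fun r => Φ r y) (a := 0) (b := 1) (δ := ‖x - y‖) (fun _ => hη)
    (fun t _ => (hΦ t x).continuousAt.continuousWithinAt) (fun t _ => (hΦ t x).hasDerivWithinAt)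
    (fun t _ => (hΦ t y).continuousAt.continuousWithinAt) (fun t _ => (hΦ t y).hasDerivWithinAt)
    (by simp [hΦ0, dist_eq_norm]) s ⟨hs, hs1⟩
  rw [dist_eq_norm, sub_zero, mul_comm] at h
  refine h.trans ?_
  gcongr
  nlinarith [K.coe_nonneg]

lemma norm_flow_sub_sub_le_of_nonneg (hη : LipschitzWith K η) (hζ : LipschitzWith K' ζ)
    (hΦ0 : Φ 0 = id) (hΦ : ∀ s x, HasDerivAt (fun r => Φ r x) (η (Φ s x)) s)
    (hηΦ : ∀ s x, HasDerivAt (fun r => η (Φ r x)) (ζ (Φ s x)) s) {s : ℝ} (hs : 0 ≤ s)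
    (hs1 : s ≤ 1) (x y : E) :
    ‖(Φ s x - x - s • η x) - (Φ s y - y - s • η y)‖ ≤ K' * Real.exp K * s ^ 2 * ‖x - y‖ := by
  have hmv : ∀ (w w' : ℝ → E) (c t : ℝ), 0 ≤ t → (∀ r, HasDerivAt w (w' r) r) →
      (∀ r ∈ Set.Icc 0 t, ‖w' r‖ ≤ c) → ‖w t - w 0‖ ≤ c * t := by
    intro w w' c t ht hw hc
    simpa [abs_of_nonneg ht] using (convex_Icc 0 t).norm_image_sub_le_of_norm_hasDerivWithin_le
      (fun r _ => (hw r).hasDerivWithinAt) hc (Set.left_mem_Icc.2 ht) (Set.right_mem_Icc.2 ht)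
  have hη' : ∀ t ∈ Set.Icc 0 s, ‖(η (Φ t x) - η (Φ t y)) - (η x - η y)‖ ≤
      K' * Real.exp K * ‖x - y‖ * s := by
    intro t ht
    have h := hmv (fun r => η (Φ r x) - η (Φ r y)) (fun r => ζ (Φ r x) - ζ (Φ r y))
      (K' * Real.exp K * ‖x - y‖) t ht.1 (fun r => (hηΦ r x).sub (hηΦ r y)) (by
        intro r hr
        refine (hζ.norm_sub_le _ _).trans ?_
        rw [mul_assoc]
        gcongr
        exact norm_flow_sub_le_of_nonneg hη hΦ0 hΦ hr.1 (hr.2.trans (ht.2.trans hs1)) x y)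
    simp only [hΦ0, id] at h
    refine h.trans ?_
    gcongr
    exact ht.2
  have h := hmv (fun r => (Φ r x - x - r • η x) - (Φ r y - y - r • η y))
    (fun r => (η (Φ r x) - η (Φ r y)) - (η x - η y)) _ s hs (by
      intro r
      have hx := ((hΦ r x).sub_const x).sub ((hasDerivAt_id r).smul_const (η x))
      have hy := ((hΦ r y).sub_const y).sub ((hasDerivAt_id r).smul_const (η y))
      refine (hx.sub hy).congr_deriv ?_
      rw [one_smul, one_smul]
      abel) hη'
  simp only [hΦ0, id, sub_self, zero_smul, sub_zero] at h
  refine h.trans (le_of_eq ?_)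
  ring

lemma norm_flow_sub_sub_le (hη : LipschitzWith K η) (hζ : LipschitzWith K' ζ)
    (hΦ0 : Φ 0 = id) (hΦ : ∀ s x, HasDerivAt (fun r => Φ r x) (η (Φ s x)) s)
    (hηΦ : ∀ s x, HasDerivAt (fun r => η (Φ r x)) (ζ (Φ s x)) s) {s : ℝ} (hs : |s| ≤ 1)
    (x y : E) :
    ‖(Φ s x - x - s • η x) - (Φ s y - y - s • η y)‖ ≤ K' * Real.exp K * s ^ 2 * ‖x - y‖ := by
  rw [abs_le] at hs
  rcases le_total 0 s with h0 | h0
  · exact norm_flow_sub_sub_le_of_nonneg hη hζ hΦ0 hΦ hηΦ h0 hs.2 x y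
  · have h := norm_flow_sub_sub_le_of_nonneg (η := fun x => -η x) (ζ := ζ)
      (Φ := fun r => Φ (-r)) (K := K) (K' := K') hη.neg hζ (by simpa using hΦ0)
      (fun t x => by simpa [Function.comp_def] using (hΦ (-t) x).scomp t (hasDerivAt_neg t))
      (fun t x => by
        simpa [Function.comp_def] using ((hηΦ (-t) x).scomp t (hasDerivAt_neg t)).fun_neg)
      (s := -s) (by linarith) (by linarith) x y
    simpa using h

end Flow

section Det

variable {E : Type*} [NormedAddCommGroup E] [NormedSpace ℝ E] [FiniteDimensional ℝ E]

lemma differentiable_det : Differentiable ℝ (fun A : E →L[ℝ] E => A.det) := by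
  let b := Module.finBasis ℝ E
  have h : (fun A : E →L[ℝ] E => A.det) =
      fun A : E →L[ℝ] E => ∑ σ : Equiv.Perm (Fin (Module.finrank ℝ E)),
        Equiv.Perm.sign σ • ∏ i, (b.coord (σ i)).toContinuousLinearMap (A (b i)) := by
    ext A
    rw [ContinuousLinearMap.det, ← LinearMap.det_toMatrix b, Matrix.det_apply]
    simp [LinearMap.toMatrix_apply]
  rw [h]
  fun_prop

lemma hasFDerivAt_det_one_add :
    HasFDerivAt (fun H : E →L[ℝ] E => (1 + H).det)
      (LinearMap.toContinuousLinearMap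
        ((LinearMap.trace ℝ E).comp (ContinuousLinearMap.coeLM ℝ))) 0 := by
  have hd : DifferentiableAt ℝ (fun H : E →L[ℝ] E => (1 + H).det) 0 :=
    (differentiable_det.comp (differentiable_const (1 : E →L[ℝ] E) |>.add differentiable_id)) 0
  refine hd.hasFDerivAt.congr_fderiv ?_
  ext H
  have h₁ : HasDerivAt (fun r : ℝ => (1 + r • H).det)
      (fderiv ℝ (fun H : E →L[ℝ] E => (1 + H).det) 0 H) 0 := by
    have hl : HasDerivAt (fun r : ℝ => r • H) ((1 : ℝ) • H) 0 :=
      (hasDerivAt_id (0 : ℝ)).smul_const H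
    rw [one_smul] at hl
    exact HasFDerivAt.comp_hasDerivAt (0 : ℝ) (by simpa using hd.hasFDerivAt) hl
  have h₂ : HasDerivAt (fun r : ℝ => (1 + r • H).det) (LinearMap.trace ℝ E H) 0 := by
    let b := Module.finBasis ℝ E
    let M := LinearMap.toMatrix b b (H : E →ₗ[ℝ] E)
    let P := (1 + (Polynomial.X : Polynomial ℝ) • M.map Polynomial.C).det.divX.divX
    have h : (fun r : ℝ => (1 + r • H).det) =
        fun r => 1 + M.trace * r + Polynomial.eval r P * r ^ 2 := by
      ext r
      rw [← Matrix.det_one_add_smul, ContinuousLinearMap.det, ← LinearMap.det_toMatrix b]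
      congr 1
      simp [M, LinearMap.toMatrix_one]
    rw [h, LinearMap.trace_eq_matrix_trace ℝ b]
    have hP := (((hasDerivAt_id (0 : ℝ)).const_mul M.trace).const_add 1).add
      ((P.hasDerivAt 0).mul (hasDerivAt_pow 2 (0 : ℝ)))
    exact hP.congr_deriv (by simp [M])
  exact h₁.unique h₂

end Det
section ChangeOfVariables

variable {E : Type*} [NormedAddCommGroup E] [NormedSpace ℝ E] [FiniteDimensional ℝ E]
  [MeasurableSpace E] [BorelSpace E]

lemma LipschitzWith.addHaar_image_eq_zero (μ : Measure E) [μ.IsAddHaarMeasure] {K : ℝ≥0}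
    {g : E → E} (hg : LipschitzWith K g) {s : Set E} (hs : μ s = 0) : μ (g '' s) = 0 := by
  let H : Measure E := Measure.hausdorffMeasure (Module.finrank ℝ E)
  have h₁ : H ≪ μ := Measure.absolutelyContinuous_isAddHaarMeasure _ _
  have h₂ : μ ≪ H := Measure.absolutelyContinuous_isAddHaarMeasure _ _
  refine h₂ (le_antisymm ?_ zero_le)
  refine (hg.hausdorffMeasure_image_le (by positivity) s).trans ?_
  rw [show Measure.hausdorffMeasure (Module.finrank ℝ E : ℝ) s = 0 from h₁ hs, mul_zero]

lemma map_withDensity_abs_det_fderiv_eq (μ : Measure E) [μ.IsAddHaarMeasure] {K : ℝ≥0}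
    (e : E ≃ₜ E) (he : LipschitzWith K e) :
    Measure.map e (μ.withDensity fun x => ENNReal.ofReal |(fderiv ℝ e x).det|) = μ := by
  let s : Set E := {x | DifferentiableAt ℝ e x}
  have hs : ∀ᵐ x ∂μ, x ∈ s := he.ae_differentiableAt
  have h := map_withDensity_abs_det_fderiv_eq_addHaar μ
    (measurableSet_of_differentiableAt ℝ e).nullMeasurableSet
    (fun x (hx : x ∈ s) => hx.hasFDerivAt.hasFDerivWithinAt) e.injective.injOn
  rw [Measure.restrict_eq_self_of_ae_mem hs, Measure.restrict_eq_self_of_ae_mem] at h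
  · exact h
  · rw [ae_iff]
    have : {a | a ∉ e '' s} = e '' sᶜ := by
      rw [Set.image_compl_eq e.bijective]; rfl
    rw [this]
    exact he.addHaar_image_eq_zero μ hs

end ChangeOfVariables

lemma integral_comp_dens_map {d : ℕ} {K : ℝ≥0} (e : Euc d ≃ₜ Euc d) (he : LipschitzWith K e)
    {J : Euc d → ℝ} (hJm : Measurable J) (hJ0 : ∀ x, 0 < J x)
    (hJ : ∀ᵐ x, J x = |(fderiv ℝ e x).det|) (ν : Measure (Euc d)) [SigmaFinite ν] (F : ℝ → ℝ) :
    ∫ x, F (dens (Measure.map e ν) x) = ∫ y, F (dens ν y / J y) * J y := by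
  let j : Euc d → ℝ≥0∞ := fun x => ENNReal.ofReal (J x)
  have hj : Measurable j := hJm.ennreal_ofReal
  have hvol : Measure.map e ((volume : Measure (Euc d)).withDensity j) = volume := by
    refine (congrArg (Measure.map e) (withDensity_congr_ae ?_)).trans
      (map_withDensity_abs_det_fderiv_eq volume e he)
    filter_upwards [hJ] with x hx
    simp only [j, hx]
  have hsf : SigmaFinite ((volume : Measure (Euc d)).withDensity j) :=
    SigmaFinite.withDensity_of_ne_top (ae_of_all _ fun x => ENNReal.ofReal_ne_top)
  have hac : (volume : Measure (Euc d)) ≪ volume.withDensity j :=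
    withDensity_absolutelyContinuous' hj.aemeasurable
      (ae_of_all _ fun x => (ENNReal.ofReal_pos.2 (hJ0 x)).ne')
  have h₁ := hac.ae_le (e.measurableEmbedding.rnDeriv_map ν (volume.withDensity j))
  rw [hvol] at h₁
  have h₂ := Measure.rnDeriv_withDensity_right ν volume hj.aemeasurable
    (ae_of_all _ fun x => (ENNReal.ofReal_pos.2 (hJ0 x)).ne')
    (ae_of_all _ fun x => ENNReal.ofReal_ne_top)
  have h₃ : ∫ x, F (dens (Measure.map e ν) x) =
      ∫ x, F (dens (Measure.map e ν) x) ∂(Measure.map e (volume.withDensity j)) := by rw [hvol]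
  rw [h₃, e.measurableEmbedding.integral_map,
    integral_withDensity_eq_integral_toReal_smul hj (ae_of_all _ fun x => ENNReal.ofReal_lt_top)]
  refine integral_congr_ae ?_
  filter_upwards [h₁, h₂] with y hy₁ hy₂
  have : dens (Measure.map e ν) (e y) = dens ν y / J y := by
    rw [dens, hy₁, hy₂, ENNReal.toReal_mul, ENNReal.toReal_inv,
      ENNReal.toReal_ofReal (hJ0 y).le, dens, div_eq_inv_mul]
  simp only [this, j, ENNReal.toReal_ofReal (hJ0 y).le, smul_eq_mul, mul_comm]

lemma hasDerivAt_integral_of_dominated_loc_of_lip' {X : Type*} [MeasurableSpace X]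
    {μ : Measure X} {F : ℝ → X → ℝ} {F' bound : X → ℝ} {x₀ : ℝ} {s : Set ℝ} (hs : s ∈ 𝓝 x₀)
    (hF_meas : ∀ x ∈ s, AEStronglyMeasurable (F x) μ) (hF_int : Integrable (F x₀) μ)
    (hF'_meas : AEStronglyMeasurable F' μ)
    (h_lipsch : ∀ᵐ a ∂μ, ∀ x ∈ s, |F x a - F x₀ a| ≤ bound a * |x - x₀|)
    (bound_integrable : Integrable bound μ)
    (h_diff : ∀ᵐ a ∂μ, HasDerivAt (F · a) (F' a) x₀) :
    HasDerivAt (fun x ↦ ∫ a, F x a ∂μ) (∫ a, F' a ∂μ) x₀ := by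
  have h := hasFDerivAt_integral_of_dominated_loc_of_lip' (𝕜 := ℝ) hs hF_meas hF_int
    ((ContinuousLinearMap.toSpanSingletonCLE (𝕜 := ℝ) (E := ℝ)).continuous.comp_aestronglyMeasurable
      hF'_meas) h_lipsch bound_integrable
    (h_diff.mono fun a ha => ha.hasFDerivAt)
  refine h.2.hasDerivAt.congr_deriv ?_
  rw [ContinuousLinearMap.integral_apply h.1]
  simp

section Pressure

variable {u : ℝ → ℝ} {C : ℝ} {m : ℕ}

lemma hasDerivAt_of_contDiffOn_two (huC2 : ContDiffOn ℝ 2 u (Set.Ioi 0)) {s : ℝ} (hs : 0 < s) :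
    HasDerivAt u (deriv u s) s :=
  ((huC2.differentiableOn (by norm_num)).differentiableAt (Ioi_mem_nhds hs)).hasDerivAt

lemma differentiableOn_press (huC2 : ContDiffOn ℝ 2 u (Set.Ioi 0)) :
    DifferentiableOn ℝ (press u) (Set.Ioi 0) := by
  have h := huC2.deriv_of_isOpen (m := 1) isOpen_Ioi (by norm_num)
  exact ((h.differentiableOn (by norm_num)).mul differentiableOn_id).sub
    (huC2.differentiableOn (by norm_num))

lemma hasDerivAt_press (huC2 : ContDiffOn ℝ 2 u (Set.Ioi 0)) {s : ℝ} (hs : 0 < s) :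
    HasDerivAt (press u) (deriv (press u) s) s :=
  ((differentiableOn_press huC2).differentiableAt (Ioi_mem_nhds hs)).hasDerivAt

lemma press_nonneg (huconv : ConvexOn ℝ (Set.Ici 0) u) (huC2 : ContDiffOn ℝ 2 u (Set.Ioi 0))
    (hu0 : u 0 = 0) {s : ℝ} (hs : 0 ≤ s) : 0 ≤ press u s := by
  rcases hs.eq_or_lt with rfl | hs
  · simp [press, hu0]
  · have h := huconv.slope_le_of_hasDerivAt (Set.mem_Ici.2 le_rfl) (Set.mem_Ici.2 hs.le) hs
      (hasDerivAt_of_contDiffOn_two huC2 hs)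
    rw [slope_def_field, hu0, sub_zero, sub_zero, div_le_iff₀ hs] at h
    rw [press]
    linarith

lemma le_press (huconv : ConvexOn ℝ (Set.Ici 0) u) (huC2 : ContDiffOn ℝ 2 u (Set.Ioi 0))
    (hu0 : u 0 = 0) (hplb : ∀ s : ℝ, 0 < s → s ^ m / C ≤ deriv (press u) s)
    {s : ℝ} (hs : 1 ≤ s) : (s ^ (m + 1) - 1) / (C * (m + 1)) ≤ press u s := by
  have hd : ∀ t : ℝ, 0 < t → HasDerivAt (fun t => press u t - t ^ (m + 1) / (C * (m + 1)))
      (deriv (press u) t - t ^ m / C) t := by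
    intro t ht
    refine ((hasDerivAt_press huC2 ht).sub
      ((hasDerivAt_pow (m + 1) t).div_const (C * (m + 1)))).congr_deriv ?_
    have hm : (m : ℝ) + 1 ≠ 0 := by positivity
    push_cast
    rw [mul_comm C, mul_div_mul_left _ _ hm]
  have hmono : MonotoneOn (fun t => press u t - t ^ (m + 1) / (C * (m + 1))) (Set.Ici 1) := by
    refine monotoneOn_of_hasDerivWithinAt_nonneg (convex_Ici 1)
      (fun t ht => (hd t (zero_lt_one.trans_le ht)).continuousAt.continuousWithinAt)
      (fun t ht => (hd t ?_).hasDerivWithinAt) (fun t ht => ?_)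
    · exact zero_lt_one.trans_le (interior_subset ht)
    · exact sub_nonneg.2 (hplb t (zero_lt_one.trans_le (interior_subset ht)))
  have h := hmono (Set.mem_Ici.2 le_rfl) (Set.mem_Ici.2 hs) hs
  have h1 := press_nonneg huconv huC2 hu0 zero_le_one
  simp only [one_pow] at h
  rw [sub_div]
  linarith

lemma exponent_ne_zero (hC : 0 < C) (huconv : ConvexOn ℝ (Set.Ici 0) u)
    (huC2 : ContDiffOn ℝ 2 u (Set.Ioi 0)) (hu0 : u 0 = 0)
    (hpub : ∀ s : ℝ, 0 ≤ s → press u s ≤ C * s ^ m)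
    (hplb : ∀ s : ℝ, 0 < s → s ^ (m - 1) / C ≤ deriv (press u) s) : m ≠ 0 := by
  rintro rfl
  have hs : (1 : ℝ) ≤ C * C + 2 := by nlinarith
  have h := le_press (m := 0) huconv huC2 hu0 hplb hs
  have h' := hpub (C * C + 2) (by linarith)
  simp only [zero_add, pow_one, Nat.cast_zero, mul_one, pow_zero] at h h'
  rw [div_le_iff₀ hC] at h
  nlinarith

lemma exists_pow_le (hC : 0 < C) (huconv : ConvexOn ℝ (Set.Ici 0) u)
    (huC2 : ContDiffOn ℝ 2 u (Set.Ioi 0)) (hu0 : u 0 = 0)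
    (hplb : ∀ s : ℝ, 0 < s → s ^ (m - 1) / C ≤ deriv (press u) s) (hm : m ≠ 0) :
    ∃ A B : ℝ, ∀ s : ℝ, 0 ≤ s → s ^ m ≤ A * s + B * |u s| := by
  rcases m with _ | _ | k
  · exact absurd rfl hm
  · exact ⟨1, 0, fun s _ => by simp⟩
  simp only [Nat.add_sub_cancel] at hplb
  set b : ℝ := 1 / (C * (k + 2)) with hb
  set a : ℝ := b / (k + 1) with ha
  have hb0 : 0 < b := by positivity
  have ha0 : 0 < a := by positivity
  have hd : ∀ t : ℝ, 0 < t → HasDerivAt (fun t => u t / t - a * t ^ (k + 1) - b / t)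
      ((press u t - b * (t ^ (k + 2) - 1)) / t ^ 2) t := by
    intro t ht
    have h1 := (hasDerivAt_of_contDiffOn_two huC2 ht).div (hasDerivAt_id t) ht.ne'
    have h2 := (hasDerivAt_pow (k + 1) t).const_mul a
    have h3 := (hasDerivAt_const t b).div (hasDerivAt_id t) ht.ne'
    refine ((h1.sub h2).sub h3).congr_deriv ?_
    have hk : (k : ℝ) + 1 ≠ 0 := by positivity
    simp only [press, id, ha, Nat.add_sub_cancel]
    push_cast
    field_simp
    ring
  have hmono : MonotoneOn (fun t => u t / t - a * t ^ (k + 1) - b / t) (Set.Ici 1) := by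
    refine monotoneOn_of_hasDerivWithinAt_nonneg (convex_Ici 1)
      (fun t ht => (hd t (zero_lt_one.trans_le ht)).continuousAt.continuousWithinAt)
      (fun t ht => (hd t ?_).hasDerivWithinAt) (fun t ht => ?_)
    · exact zero_lt_one.trans_le (interior_subset ht)
    · refine div_nonneg (sub_nonneg.2 ?_) (sq_nonneg t)
      have h := le_press (m := k + 1) huconv huC2 hu0 hplb (interior_subset ht)
      refine le_trans (le_of_eq ?_) h
      rw [hb]
      push_cast
      ring
  refine ⟨1 + |u 1 - a - b| / a, 1 / a, fun s hs => ?_⟩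
  rcases le_total s 1 with h1 | h1
  · have h2 : s ^ (k + 1 + 1) ≤ s := pow_le_of_le_one hs h1 (by omega)
    have h3 : 0 ≤ |u 1 - a - b| / a * s := by positivity
    have h4 : 0 ≤ 1 / a * |u s| := by positivity
    linarith
  · have hs0 : 0 < s := by linarith
    have h := hmono (Set.mem_Ici.2 le_rfl) (Set.mem_Ici.2 h1) h1
    simp only [one_pow, div_one, mul_one] at h
    have h2 : a * s ^ (k + 2) ≤ u s - (u 1 - a - b) * s := by
      have h3 := mul_le_mul_of_nonneg_right h hs0.le
      have h4 : (u s / s - a * s ^ (k + 1) - b / s) * s = u s - a * s ^ (k + 2) - b := by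
        field_simp
        ring
      rw [h4] at h3
      linarith
    have h5 : -(u 1 - a - b) * s ≤ |u 1 - a - b| * s :=
      mul_le_mul_of_nonneg_right (neg_le_abs _) hs0.le
    have h6 : a * s ^ (k + 2) ≤ a * s + |u 1 - a - b| * s + |u s| := by
      nlinarith [le_abs_self (u s), mul_pos ha0 hs0]
    have h7 : (1 + |u 1 - a - b| / a) * s + 1 / a * |u s| =
        (a * s + |u 1 - a - b| * s + |u s|) / a := by
      field_simp
    rw [h7, le_div_iff₀ ha0, mul_comm]
    exact h6

lemma hasDerivAt_div_mul (huC2 : ContDiffOn ℝ 2 u (Set.Ioi 0)) (hu0 : u 0 = 0) {r J : ℝ}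
    (hr : 0 ≤ r) (hJ : 0 < J) :
    HasDerivAt (fun J => u (r / J) * J) (-press u (r / J)) J := by
  rcases hr.eq_or_lt with rfl | hr
  · simpa [press, hu0] using hasDerivAt_const J (0 : ℝ)
  · have h1 : HasDerivAt (fun J : ℝ => r / J) (-r / J ^ 2) J := by
      simpa using (hasDerivAt_const J r).fun_div (hasDerivAt_id J) hJ.ne'
    have h2 := (hasDerivAt_of_contDiffOn_two huC2 (div_pos hr hJ)).comp J h1
    refine (h2.mul (hasDerivAt_id J)).congr_deriv ?_
    simp only [press, Function.comp, id]
    field_simp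
    ring

lemma abs_div_mul_sub_le (huconv : ConvexOn ℝ (Set.Ici 0) u)
    (huC2 : ContDiffOn ℝ 2 u (Set.Ioi 0)) (hu0 : u 0 = 0) (hC : 0 < C)
    (hpub : ∀ s : ℝ, 0 ≤ s → press u s ≤ C * s ^ m) {r J : ℝ} (hr : 0 ≤ r) (hJ : 1 / 2 ≤ J) :
    |u (r / J) * J - u r| ≤ C * 2 ^ m * r ^ m * |J - 1| := by
  have h := (convex_Ici (1 / 2 : ℝ)).norm_image_sub_le_of_norm_hasDerivWithin_le
    (f := fun J => u (r / J) * J) (f' := fun J => -press u (r / J)) (C := C * 2 ^ m * r ^ m)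
    (x := 1) (y := J)
    (fun x hx => (hasDerivAt_div_mul huC2 hu0 hr (by
      have : (1 / 2 : ℝ) ≤ x := hx
      linarith)).hasDerivWithinAt) (fun x hx => ?_) (by norm_num) hJ
  · simpa using h
  · have hx' : (1 / 2 : ℝ) ≤ x := hx
    have hx0 : 0 < x := by linarith
    have h0 : 0 ≤ r / x := by positivity
    rw [norm_neg, Real.norm_of_nonneg (press_nonneg huconv huC2 hu0 h0)]
    refine (hpub _ h0).trans ?_
    have h2 : r / x ≤ 2 * r := by
      rw [div_le_iff₀ hx0]
      nlinarith
    calc C * (r / x) ^ m ≤ C * (2 * r) ^ m := by gcongr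
      _ = C * 2 ^ m * r ^ m := by rw [mul_pow]; ring

end Pressure

lemma ContinuousOn.measurable_comp_nonneg {X : Type*} [MeasurableSpace X] {v : ℝ → ℝ}
    (hv : ContinuousOn v (Set.Ioi 0)) {n : X → ℝ} (hn : Measurable n) (hn0 : ∀ x, 0 ≤ n x) :
    Measurable fun x => v (n x) := by
  have h : Measurable ((Set.Ioi (0 : ℝ)).piecewise v fun _ => v 0) :=
    hv.measurable_piecewise continuousOn_const measurableSet_Ioi
  have h' : (fun x => v (n x)) = fun x => (Set.Ioi (0 : ℝ)).piecewise v (fun _ => v 0) (n x) := by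
    ext x
    rcases (hn0 x).eq_or_lt with h0 | h0
    · simp [← h0]
    · rw [Set.piecewise_eq_of_mem _ _ _ (Set.mem_Ioi.2 h0)]
  rw [h']
  exact h.comp hn

section Jacobian

variable {d : ℕ} {η : Euc d → Euc d} {Φ : ℝ → Euc d → Euc d} {L M : ℝ≥0}

/-- `DΦ_s(x) - 1` where `Φ_s` is differentiable, and its first-order approximation `s Dη(x)`
elsewhere. -/
def fderivFlowSubOne (η : Euc d → Euc d) (Φ : ℝ → Euc d → Euc d) (s : ℝ) (x : Euc d) :
    Euc d →L[ℝ] Euc d :=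
  if DifferentiableAt ℝ (Φ s) x then fderiv ℝ (Φ s) x - 1 else s • fderiv ℝ η x

lemma norm_fderivFlowSubOne_sub_le (hη : Differentiable ℝ η)
    (hΦ : ∀ s : ℝ, |s| ≤ 1 → ∀ x y,
      ‖(Φ s x - x - s • η x) - (Φ s y - y - s • η y)‖ ≤ M * s ^ 2 * ‖x - y‖)
    {s : ℝ} (hs : |s| ≤ 1) (x : Euc d) :
    ‖fderivFlowSubOne η Φ s x - s • fderiv ℝ η x‖ ≤ M * s ^ 2 := by
  rw [fderivFlowSubOne]
  split_ifs with h
  · have h1 : HasFDerivAt (fun x => Φ s x - x - s • η x)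
        (fderiv ℝ (Φ s) x - 1 - s • fderiv ℝ η x) x :=
      (h.hasFDerivAt.sub (hasFDerivAt_id x)).sub ((hη x).hasFDerivAt.const_smul s)
    have hlip : LipschitzWith (M * ⟨s ^ 2, sq_nonneg s⟩) (fun x => Φ s x - x - s • η x) :=
      LipschitzWith.of_dist_le_mul fun x y => by
        rw [dist_eq_norm, dist_eq_norm]
        exact hΦ s hs x y
    rw [← h1.fderiv]
    exact norm_fderiv_le_of_lipschitz ℝ hlip
  · rw [sub_self, norm_zero]
    positivity

lemma norm_fderivFlowSubOne_le (hη : Differentiable ℝ η) (hL : LipschitzWith L η)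
    (hΦ : ∀ s : ℝ, |s| ≤ 1 → ∀ x y,
      ‖(Φ s x - x - s • η x) - (Φ s y - y - s • η y)‖ ≤ M * s ^ 2 * ‖x - y‖)
    {s : ℝ} (hs : |s| ≤ 1) (x : Euc d) :
    ‖fderivFlowSubOne η Φ s x‖ ≤ (L + M) * |s| := by
  have h1 := norm_fderivFlowSubOne_sub_le hη hΦ hs x
  have h2 : ‖s • fderiv ℝ η x‖ ≤ |s| * L := by
    rw [norm_smul, Real.norm_eq_abs]
    gcongr
    exact norm_fderiv_le_of_lipschitz ℝ hL
  have h3 := norm_le_norm_sub_add (fderivFlowSubOne η Φ s x) (s • fderiv ℝ η x)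
  have h4 : M * s ^ 2 ≤ M * |s| := by
    rw [← sq_abs]
    gcongr
    nlinarith [abs_nonneg s]
  linarith

lemma hasDerivAt_fderivFlowSubOne (hη : Differentiable ℝ η)
    (hΦ : ∀ s : ℝ, |s| ≤ 1 → ∀ x y,
      ‖(Φ s x - x - s • η x) - (Φ s y - y - s • η y)‖ ≤ M * s ^ 2 * ‖x - y‖) (x : Euc d) :
    HasDerivAt (fun s => fderivFlowSubOne η Φ s x) (fderiv ℝ η x) 0 := by
  have hO : (fun s => fderivFlowSubOne η Φ s x - s • fderiv ℝ η x) =O[𝓝 (0 : ℝ)]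
      fun s => ‖s - 0‖ ^ 2 := by
    refine Asymptotics.IsBigO.of_bound M ?_
    filter_upwards [Metric.closedBall_mem_nhds (0 : ℝ) one_pos] with s hs
    have h := norm_fderivFlowSubOne_sub_le hη hΦ (by simpa using hs) x
    simpa using h
  have h1 := (hO.hasFDerivAt one_lt_two).hasDerivAt
  have h2 := h1.add ((hasDerivAt_id (0 : ℝ)).smul_const (fderiv ℝ η x))
  have h3 : HasDerivAt (fun s => fderivFlowSubOne η Φ s x)
      ((0 : ℝ →L[ℝ] (Euc d →L[ℝ] Euc d)) 1 + (1 : ℝ) • fderiv ℝ η x) 0 :=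
    h2.congr_of_eventuallyEq (.of_forall fun s => by simp)
  simpa using h3

lemma fderivFlowSubOne_zero (hη : Differentiable ℝ η)
    (hΦ : ∀ s : ℝ, |s| ≤ 1 → ∀ x y,
      ‖(Φ s x - x - s • η x) - (Φ s y - y - s • η y)‖ ≤ M * s ^ 2 * ‖x - y‖) (x : Euc d) :
    fderivFlowSubOne η Φ 0 x = 0 := by
  have h := norm_fderivFlowSubOne_sub_le (s := 0) hη hΦ (by simp) x
  rw [zero_smul ℝ (fderiv ℝ η x)] at h
  simpa using h

/-- The Jacobian determinant of `Φ_s`, completed on the null set where `Φ_s` is not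
differentiable. -/
def jacobianFlow (η : Euc d → Euc d) (Φ : ℝ → Euc d → Euc d) (s : ℝ) (x : Euc d) : ℝ :=
  (1 + fderivFlowSubOne η Φ s x).det

lemma measurable_jacobianFlow (s : ℝ) : Measurable (jacobianFlow η Φ s) := by
  have h : Measurable (fderivFlowSubOne η Φ s) :=
    Measurable.ite (measurableSet_of_differentiableAt ℝ (Φ s))
      ((measurable_fderiv ℝ (Φ s)).sub_const 1) ((measurable_fderiv ℝ η).const_smul s)
  have hc : Continuous fun H : Euc d →L[ℝ] Euc d => (1 + H).det :=
    ContinuousLinearMap.continuous_det.comp (continuous_const.add continuous_id)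
  exact hc.measurable.comp h

lemma jacobianFlow_zero (hη : Differentiable ℝ η)
    (hΦ : ∀ s : ℝ, |s| ≤ 1 → ∀ x y,
      ‖(Φ s x - x - s • η x) - (Φ s y - y - s • η y)‖ ≤ M * s ^ 2 * ‖x - y‖) (x : Euc d) :
    jacobianFlow η Φ 0 x = 1 := by
  simp [jacobianFlow, fderivFlowSubOne_zero hη hΦ, ContinuousLinearMap.det]

lemma hasDerivAt_jacobianFlow (hη : Differentiable ℝ η)
    (hΦ : ∀ s : ℝ, |s| ≤ 1 → ∀ x y,
      ‖(Φ s x - x - s • η x) - (Φ s y - y - s • η y)‖ ≤ M * s ^ 2 * ‖x - y‖) (x : Euc d) :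
    HasDerivAt (fun s => jacobianFlow η Φ s x) (divg η x) 0 := by
  have h1 : HasFDerivAt (fun H : Euc d →L[ℝ] Euc d => (1 + H).det)
      (LinearMap.toContinuousLinearMap
        ((LinearMap.trace ℝ (Euc d)).comp (ContinuousLinearMap.coeLM ℝ)))
    (fderivFlowSubOne η Φ 0 x) := by
    rw [fderivFlowSubOne_zero hη hΦ]
    exact hasFDerivAt_det_one_add
  exact h1.comp_hasDerivAt (0 : ℝ) (hasDerivAt_fderivFlowSubOne hη hΦ x)

lemma exists_abs_jacobianFlow_sub_one_le (hη : Differentiable ℝ η) (hL : LipschitzWith L η)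
    (hΦ : ∀ s : ℝ, |s| ≤ 1 → ∀ x y,
      ‖(Φ s x - x - s • η x) - (Φ s y - y - s • η y)‖ ≤ M * s ^ 2 * ‖x - y‖) :
    ∃ c : ℝ, ∀ᶠ s in 𝓝 (0 : ℝ), ∀ x, |jacobianFlow η Φ s x - 1| ≤ c * |s| := by
  obtain ⟨c, hc, hcO⟩ :=
    (hasFDerivAt_det_one_add (E := Euc d)).isBigO_sub.exists_pos
  have hb := hcO.bound
  obtain ⟨ε, hε, hball⟩ := Metric.eventually_nhds_iff.1 hb
  refine ⟨c * (L + M), ?_⟩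
  have hlim : Tendsto (fun s : ℝ => (L + M : ℝ) * |s|) (𝓝 0) (𝓝 0) := by
    have : Continuous fun s : ℝ => (L + M : ℝ) * |s| := by fun_prop
    simpa using this.tendsto 0
  filter_upwards [Metric.closedBall_mem_nhds (0 : ℝ) one_pos, hlim.eventually_lt_const hε]
    with s hs hsε x
  have hH := norm_fderivFlowSubOne_le hη hL hΦ (s := s) (by simpa using hs) x
  have h := hball (y := fderivFlowSubOne η Φ s x) (by simpa using hH.trans_lt hsε)
  have h1 : ((1 : Euc d →L[ℝ] Euc d) + 0).det = 1 := by simp [ContinuousLinearMap.det]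
  rw [h1, sub_zero, Real.norm_eq_abs] at h
  refine h.trans ?_
  rw [mul_assoc]
  gcongr

lemma exists_homeomorph_flow (hL : LipschitzWith L η)
    (hΦ : ∀ s : ℝ, |s| ≤ 1 → ∀ x y,
      ‖(Φ s x - x - s • η x) - (Φ s y - y - s • η y)‖ ≤ M * s ^ 2 * ‖x - y‖) :
    ∀ᶠ s in 𝓝 (0 : ℝ), ∃ (e : Euc d ≃ₜ Euc d) (K : ℝ≥0), ⇑e = Φ s ∧ LipschitzWith K e := by
  have hlim : Tendsto (fun s : ℝ => (L + M) * ‖s‖₊) (𝓝 0) (𝓝 0) := by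
    have : Continuous fun s : ℝ => (L + M) * ‖s‖₊ := by fun_prop
    simpa using this.tendsto 0
  filter_upwards [Metric.closedBall_mem_nhds (0 : ℝ) one_pos, hlim.eventually_lt_const one_pos]
    with s hs hs1
  have hs' : |s| ≤ 1 := by simpa using hs
  have hsub : ∀ x y, ‖(Φ s x - Φ s y) - (x - y)‖ ≤ (L + M) * |s| * ‖x - y‖ := by
    intro x y
    have h1 := hΦ s hs' x y
    have h2 : ‖s • (η x - η y)‖ ≤ |s| * (L * ‖x - y‖) := by
      rw [norm_smul, Real.norm_eq_abs]
      gcongr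
      exact hL.norm_sub_le x y
    have h3 : (Φ s x - Φ s y) - (x - y) =
        ((Φ s x - x - s • η x) - (Φ s y - y - s • η y)) + s • (η x - η y) := by
      rw [smul_sub]; abel
    have h4 : M * s ^ 2 * ‖x - y‖ ≤ M * |s| * ‖x - y‖ := by
      rw [← sq_abs]
      gcongr
      nlinarith [abs_nonneg s]
    rw [h3]
    refine (norm_add_le _ _).trans ?_
    linarith
  have happ : ApproximatesLinearOn (Φ s) (ContinuousLinearEquiv.refl ℝ (Euc d) : Euc d →L[ℝ] Euc d)
      Set.univ ((L + M) * ‖s‖₊) := by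
    intro x _ y _
    simpa using hsub x y
  have hc : Subsingleton (Euc d) ∨ (L + M) * ‖s‖₊ <
      ‖((ContinuousLinearEquiv.refl ℝ (Euc d)).symm : Euc d →L[ℝ] Euc d)‖₊⁻¹ := by
    rcases subsingleton_or_nontrivial (Euc d) with h | h
    · exact Or.inl h
    · right
      have h1 : ‖((ContinuousLinearEquiv.refl ℝ (Euc d)).symm : Euc d →L[ℝ] Euc d)‖₊ = 1 :=
        NNReal.eq ContinuousLinearMap.norm_id
      rw [h1, inv_one]
      exact hs1
  refine ⟨happ.toHomeomorph (Φ s) hc, 1 + (L + M) * ‖s‖₊, rfl, ?_⟩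
  refine LipschitzWith.of_dist_le_mul fun x y => ?_
  rw [dist_eq_norm, dist_eq_norm]
  have h := norm_le_norm_sub_add (Φ s x - Φ s y) (x - y)
  have h' := hsub x y
  refine h.trans (le_of_le_of_eq (add_le_add_left h' _) ?_)
  push_cast
  rw [Real.norm_eq_abs]
  ring

lemma integral_comp_dens_map_flow (hη : Differentiable ℝ η) (hL : LipschitzWith L η)
    (hΦ : ∀ s : ℝ, |s| ≤ 1 → ∀ x y,
      ‖(Φ s x - x - s • η x) - (Φ s y - y - s • η y)‖ ≤ M * s ^ 2 * ‖x - y‖)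
    (ν : Measure (Euc d)) [SigmaFinite ν] (F : ℝ → ℝ) :
    ∀ᶠ s in 𝓝 (0 : ℝ), (∀ x, 1 / 2 ≤ jacobianFlow η Φ s x) ∧
      ∫ x, F (dens (Measure.map (Φ s) ν) x) =
        ∫ y, F (dens ν y / jacobianFlow η Φ s y) * jacobianFlow η Φ s y := by
  obtain ⟨c, hc⟩ := exists_abs_jacobianFlow_sub_one_le hη hL hΦ
  have hlim : Tendsto (fun s : ℝ => c * |s|) (𝓝 0) (𝓝 0) := by
    have : Continuous fun s : ℝ => c * |s| := by fun_prop
    simpa using this.tendsto 0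
  filter_upwards [hc, hlim.eventually_lt_const (show (0 : ℝ) < 1 / 2 by norm_num),
    exists_homeomorph_flow hL hΦ] with s hcs hs ⟨e, K, he, hK⟩
  have hpos : ∀ x, 1 / 2 ≤ jacobianFlow η Φ s x := fun x => by
    have h := (abs_le.1 ((hcs x).trans hs.le)).1
    linarith
  refine ⟨hpos, ?_⟩
  rw [← he]
  refine integral_comp_dens_map e hK (measurable_jacobianFlow s)
    (fun x => lt_of_lt_of_le (by norm_num) (hpos x)) ?_ ν F
  filter_upwards [hK.ae_differentiableAt (μ := volume)] with x hx
  have hJ : jacobianFlow η Φ s x = (fderiv ℝ e x).det := by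
    rw [he] at hx ⊢
    rw [jacobianFlow, fderivFlowSubOne, if_pos hx, add_sub_cancel]
  rw [← hJ, abs_of_pos (lt_of_lt_of_le (by norm_num) (hpos x))]

end Jacobian

lemma hasDerivAt_integral_map_flow {d : ℕ} {f : Euc d → ℝ} {C B : ℝ} (hC : 0 < C)
    (hfdiff : Differentiable ℝ f) (hfL : ∀ x y, |f x - f y| ≤ C * ‖x - y‖)
    {ν : Measure (Euc d)} (hν : IsP2r ν) {η : Euc d → Euc d} (hη : Measurable η)
    (hB : ∀ x, ‖η x‖ ≤ B) {Φ : ℝ → Euc d → Euc d} (hΦ0 : Φ 0 = id)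
    (hΦ : ∀ s : ℝ, ∀ x : Euc d, HasDerivAt (fun r => Φ r x) (η (Φ s x)) s)
    (hΦm : ∀ᶠ s in 𝓝 (0 : ℝ), Measurable (Φ s)) :
    HasDerivAt (fun s => ∫ x, f x ∂(Measure.map (Φ s) ν))
      (∫ y, dens ν y * ⟪η y, gradient f y⟫) 0 := by
  obtain ⟨⟨hprob, hM2⟩, hac⟩ := hν
  have hfm : Measurable f := hfdiff.continuous.measurable
  have hfint : Integrable f ν := by
    have h2 : Integrable (fun x : Euc d => ‖x‖ ^ 2) ν := by
      refine ⟨by fun_prop, ?_⟩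
      have h : M2 ν = ∫⁻ x : Euc d, ‖‖x‖ ^ 2‖ₑ ∂ν := by simp [M2, enorm_eq_nnnorm]
      rw [HasFiniteIntegral, ← h]
      exact hM2
    refine ((integrable_const (|f 0| + C)).add (h2.const_mul C)).mono'
      hfm.aestronglyMeasurable (ae_of_all _ fun x => ?_)
    have h3 := hfL x 0
    rw [sub_zero] at h3
    have h4 : |f x| ≤ |f x - f 0| + |f 0| := by simpa using abs_add_le (f x - f 0) (f 0)
    have h5 : ‖x‖ ≤ 1 + ‖x‖ ^ 2 := by nlinarith [sq_nonneg (‖x‖ - 1)]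
    have h6 := mul_le_mul_of_nonneg_left h5 hC.le
    simp only [Pi.add_apply, Real.norm_eq_abs]
    linarith
  have hgrad : Measurable (gradient f) :=
    (InnerProductSpace.toDual ℝ (Euc d)).symm.continuous.measurable.comp (measurable_fderiv ℝ f)
  have hmove : ∀ s x, ‖Φ s x - x‖ ≤ B * |s| := by
    intro s x
    have h := (convex_univ (𝕜 := ℝ) (E := ℝ)).norm_image_sub_le_of_norm_hasDerivWithin_le
      (fun r _ => (hΦ r x).hasDerivWithinAt) (fun r _ => hB (Φ r x)) (Set.mem_univ 0)
      (Set.mem_univ s)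
    simpa [hΦ0] using h
  have h := hasDerivAt_integral_of_dominated_loc_of_lip' (μ := ν) (F := fun s y => f (Φ s y))
    (F' := fun y => ⟪η y, gradient f y⟫) (bound := fun _ => C * B) (x₀ := 0) hΦm
    (fun s hs => (hfm.comp hs).aestronglyMeasurable) (by simpa [hΦ0] using hfint)
    (hη.inner hgrad).aestronglyMeasurable
    (ae_of_all _ fun y s _ => ?_) (integrable_const _) (ae_of_all _ fun y => ?_)
  · simp only [dens, integral_toReal_rnDeriv_mul hac]
    refine h.congr_of_eventuallyEq ?_
    filter_upwards [hΦm] with s hs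
    exact integral_map hs.aemeasurable hfm.aestronglyMeasurable
  · rw [hΦ0, id, sub_zero, mul_assoc]
    exact (hfL _ _).trans (mul_le_mul_of_nonneg_left (hmove s y) hC.le)
  · have h1 := (hfdiff (Φ 0 y)).hasFDerivAt.comp_hasDerivAt (0 : ℝ) (hΦ 0 y)
    rw [hΦ0, id] at h1
    refine h1.congr_deriv ?_
    rw [real_inner_comm, gradient, InnerProductSpace.toDual_symm_apply]

lemma hasDerivAt_internalEnergy_map_flow {d : ℕ} {u : ℝ → ℝ} {C : ℝ} {m : ℕ} (hC : 0 < C)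
    (huconv : ConvexOn ℝ (Set.Ici 0) u) (huC2 : ContDiffOn ℝ 2 u (Set.Ioi 0)) (hu0 : u 0 = 0)
    (hpub : ∀ s : ℝ, 0 ≤ s → press u s ≤ C * s ^ m)
    (hplb : ∀ s : ℝ, 0 < s → s ^ (m - 1) / C ≤ deriv (press u) s)
    {ν : Measure (Euc d)} [IsFiniteMeasure ν] (hU : internalEnergy u ν < ⊤)
    {η : Euc d → Euc d} {Φ : ℝ → Euc d → Euc d} {L M : ℝ≥0} (hη : Differentiable ℝ η)
    (hL : LipschitzWith L η)
    (hΦ : ∀ s : ℝ, |s| ≤ 1 → ∀ x y,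
      ‖(Φ s x - x - s • η x) - (Φ s y - y - s • η y)‖ ≤ M * s ^ 2 * ‖x - y‖) :
    HasDerivAt (fun s => ∫ x, u (dens (Measure.map (Φ s) ν) x))
      (∫ y, -(press u (dens ν y) * divg η y)) 0 := by
  have hn : Measurable (dens ν) := (Measure.measurable_rnDeriv ν volume).ennreal_toReal
  have hn0 : ∀ x, 0 ≤ dens ν x := fun x => ENNReal.toReal_nonneg
  have huint : Integrable (fun x => u (dens ν x)) := by
    by_contra hcon
    simp [internalEnergy, hcon] at hU
  obtain ⟨A, B, hAB⟩ := exists_pow_le hC huconv huC2 hu0 hplb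
    (exponent_ne_zero hC huconv huC2 hu0 hpub hplb)
  have hpow : Integrable (fun x => dens ν x ^ m) := by
    refine (((Measure.integrable_toReal_rnDeriv (μ := ν) (ν := volume)).const_mul A).add
      (huint.abs.const_mul B)).mono'
      (hn.pow_const m).aestronglyMeasurable (ae_of_all _ fun x => ?_)
    rw [Real.norm_of_nonneg (pow_nonneg (hn0 x) m)]
    exact hAB _ (hn0 x)
  obtain ⟨c, hc⟩ := exists_abs_jacobianFlow_sub_one_le hη hL hΦ
  have hcv := integral_comp_dens_map_flow hη hL hΦ ν u
  have hdiv : Measurable (divg η) := by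
    have h : Continuous (LinearMap.toContinuousLinearMap
        ((LinearMap.trace ℝ (Euc d)).comp (ContinuousLinearMap.coeLM ℝ))) :=
      ContinuousLinearMap.continuous _
    exact h.measurable.comp (measurable_fderiv ℝ η)
  have hJ0 := fun y => jacobianFlow_zero hη hΦ y
  have h := hasDerivAt_integral_of_dominated_loc_of_lip' (μ := volume)
    (F := fun s y => u (dens ν y / jacobianFlow η Φ s y) * jacobianFlow η Φ s y)
    (F' := fun y => -(press u (dens ν y) * divg η y))
    (bound := fun y => C * 2 ^ m * c * dens ν y ^ m) (x₀ := 0) (hc.and hcv)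
    (fun s hs => ?_) (by simpa [hJ0] using huint) ?_ (ae_of_all _ fun y s hs => ?_)
    (hpow.const_mul _) (ae_of_all _ fun y => ?_)
  · exact h.congr_of_eventuallyEq (hcv.mono fun s hs => hs.2)
  · have hJ := measurable_jacobianFlow (η := η) (Φ := Φ) s
    exact ((huC2.continuousOn.measurable_comp_nonneg (hn.div hJ) fun y =>
      div_nonneg (hn0 y) (le_trans (by norm_num) (hs.2.1 y))).mul hJ).aestronglyMeasurable
  · exact (((differentiableOn_press huC2).continuousOn.measurable_comp_nonneg hn hn0).mul
      hdiv).neg.aestronglyMeasurable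
  · simp only [hJ0, div_one, mul_one, sub_zero]
    refine (abs_div_mul_sub_le huconv huC2 hu0 hC hpub (hn0 y) (hs.2.1 y)).trans ?_
    have h1 : 0 ≤ C * 2 ^ m * dens ν y ^ m := mul_nonneg (by positivity) (pow_nonneg (hn0 y) m)
    refine (mul_le_mul_of_nonneg_left (hs.1 y) h1).trans (le_of_eq ?_)
    ring
  · have h1 : HasDerivAt (fun J => u (dens ν y / J) * J)
        (-press u (dens ν y / jacobianFlow η Φ 0 y)) (jacobianFlow η Φ 0 y) :=
      hasDerivAt_div_mul huC2 hu0 (hn0 y) (by rw [hJ0]; exact one_pos)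
    refine (h1.comp (0 : ℝ) (hasDerivAt_jacobianFlow hη hΦ y)).congr_deriv ?_
    rw [hJ0, div_one, neg_mul]

/-- Lemma 6.1, first variation of the free energy along the flow of a
compactly supported smooth vector field:
`d/ds 𝓕((Φ_s)_# ν)|_{s=0} = ∫ ν(y) ⟨η(y), ∇f(y)⟩ dy − ∫ p(ν(y)) div η(y) dy`. -/
theorem statement_7
    (d : ℕ) (f : Euc d → ℝ) (u : ℝ → ℝ) (C α : ℝ) (m : ℕ)
    (hC : 0 < C)
    -- Assumption 2.1
    (hf0 : ∀ x, 0 ≤ f x) (hfdiff : Differentiable ℝ f)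
    (hfL : ∀ x y, |f x - f y| ≤ C * ‖x - y‖)
    (huconv : ConvexOn ℝ (Set.Ici 0) u)
    (huC2 : ContDiffOn ℝ 2 u (Set.Ioi 0))
    (hu0 : u 0 = 0)
    (husuper : Tendsto (fun s => u s / s) atTop atTop)
    (hα₁ : (d : ℝ) / (d + 2) < α) (hα₂ : α < 1)
    (hulb : ∀ s : ℝ, 0 ≤ s → -C * s ^ α ≤ u s)
    (hpub : ∀ s : ℝ, 0 ≤ s → press u s ≤ C * s ^ m)
    (hplb : ∀ s : ℝ, 0 < s → s ^ (m - 1) / C ≤ deriv (press u) s)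
    -- the measure
    (ν : Measure (Euc d)) (hν : IsP2r ν) (hU : internalEnergy u ν < ⊤)
    -- the vector field and its flow
    (η : Euc d → Euc d) (hη : ContDiff ℝ (⊤ : ℕ∞) η) (hηc : HasCompactSupport η)
    (Φ : ℝ → Euc d → Euc d) (hΦ0 : Φ 0 = id)
    (hΦ : ∀ s : ℝ, ∀ x : Euc d, HasDerivAt (fun r => Φ r x) (η (Φ s x)) s) :
    HasDerivAt (fun s => freeEnergyReal f u (Measure.map (Φ s) ν))
      ((∫ y, dens ν y * ⟪η y, gradient f y⟫) - ∫ y, press u (dens ν y) * divg η y) 0 := by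
  obtain ⟨L, hL⟩ := hη.lipschitzWith_of_hasCompactSupport hηc (by simp)
  have hηd : Differentiable ℝ η := hη.differentiable (by simp)
  have hζ : ContDiff ℝ 1 fun x => fderiv ℝ η x (η x) :=
    (hη.fderiv_right (m := 1) (by norm_cast)).clm_apply (hη.of_le (by norm_cast))
  have hζc : HasCompactSupport fun x => fderiv ℝ η x (η x) :=
    hηc.mono fun x hx h0 => hx (by simp [h0])
  obtain ⟨L', hL'⟩ := hζ.lipschitzWith_of_hasCompactSupport hζc one_ne_zero
  have hflow : ∀ s : ℝ, |s| ≤ 1 → ∀ x y,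
      ‖(Φ s x - x - s • η x) - (Φ s y - y - s • η y)‖ ≤
        (L' * (Real.exp L).toNNReal : ℝ≥0) * s ^ 2 * ‖x - y‖ := by
    intro s hs x y
    rw [NNReal.coe_mul, Real.coe_toNNReal _ (Real.exp_pos _).le]
    exact norm_flow_sub_sub_le hL hL' hΦ0 hΦ
      (fun s x => (hηd (Φ s x)).hasFDerivAt.comp_hasDerivAt s (hΦ s x)) hs x y
  obtain ⟨B, hB⟩ := hηc.exists_bound_of_continuous hη.continuous
  have hΦm : ∀ᶠ s in 𝓝 (0 : ℝ), Measurable (Φ s) :=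
    (exists_homeomorph_flow hL hflow).mono fun s ⟨e, _, he, _⟩ => he ▸ e.continuous.measurable
  have := hν.1.1
  have hpot := hasDerivAt_integral_map_flow hC hfdiff hfL hν hη.continuous.measurable hB hΦ0 hΦ hΦm
  have hfint := hasDerivAt_internalEnergy_map_flow hC huconv huC2 hu0 hpub hplb hU hηd hL hflow
  refine (hpot.add hfint).congr_deriv ?_
  rw [integral_neg, ← sub_eq_add_neg]
end
end
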